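/- arXiv:1903.12526 — 4 statements merged into one kernel-verified Lean document; each statement's English description precedes it below -/
import Mathlib

section
/- For every admissible z (i.e. z ∈ ℂ, z ∉ [a,b] ∪ (−[a,b]) ∪ {0}), the operator K̂ satisfies K̂(y ↦ 1/y)(z) = s, and for every n ∈ ℕ, K̂(y ↦ 1/y^{3+2n})(z) = Σ_{k=0}^{n} ϱ_k / z^{2n+2−2k}, where ϱ_k are the moments. -/
open scoped BigOperators
open MeasureTheory

noncomputable section

namespace NCQFT

/-! ### Measure data: the planar 1‑point function `G0fun`, the moments and the operator `K̂`. -/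

/-- The planar one-point function `𝒢₀(z) = s·z − n̄ + ½∫ᵃᵇ r(y)/((z+y)y) dy`. -/
def G0fun (a b s nbar : ℝ) (r : ℝ → ℝ) (z : ℂ) : ℂ :=
  (s : ℂ) * z - (nbar : ℂ) + (1 / 2) * ∫ y in a..b, (r y : ℂ) / ((z + (y : ℂ)) * (y : ℂ))

/-- Moments `ϱ_l = s·δ_{l,0} − ½∫ᵃᵇ r(y)/y^{3+2l} dy` of the measure. -/
def moment (a b s : ℝ) (r : ℝ → ℝ) (l : ℕ) : ℝ :=
  (if l = 0 then s else 0) - (1 / 2) * ∫ y in a..b, r y / y ^ (3 + 2 * l)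

/-- The integral operator `K̂`. -/
def Khat (a b s nbar : ℝ) (r : ℝ → ℝ) (f : ℂ → ℂ) (z : ℂ) : ℂ :=
  G0fun a b s nbar r z * f z + (nbar : ℂ) * f z
    + (1 / 2) * ∫ y in a..b, (r y : ℂ) * (f z - f (y : ℂ)) / (z ^ 2 - (y : ℂ) ^ 2)

/-- Admissible points: `z ∉ [a,b] ∪ (−[a,b]) ∪ {0}`. -/
def Admissible (a b : ℝ) (z : ℂ) : Prop :=
  z ≠ 0 ∧ ∀ y : ℝ, y ∈ Set.Icc a b → z ≠ (y : ℂ) ∧ z ≠ -(y : ℂ)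

/-! ### Partial Bell polynomials and the polynomials `S_m(ϱ)`. -/

/-- Partial Bell polynomial `B_{n,k}(x₁,…,x_{n−k+1})`. -/
def bellP (n k : ℕ) (x : ℕ → ℝ) : ℝ :=
  ∑ j : Fin n → Fin (n + 1),
    if (∑ i : Fin n, (j i : ℕ)) = k ∧ (∑ i : Fin n, ((i : ℕ) + 1) * (j i : ℕ)) = n then
      (n.factorial : ℝ) / (∏ i : Fin n, ((j i : ℕ).factorial : ℝ)) *
        ∏ i : Fin n, (x ((i : ℕ) + 1) / (((i : ℕ) + 1).factorial : ℝ)) ^ (j i : ℕ)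
    else 0

/-- `S_m(ϱ) = Σ_{i=0}^m (−1)^i i! ϱ₀^{−i} B_{m,i}(1!ϱ₁,…,(m−i+1)!ϱ_{m−i+1})`. -/
def Sm (ρ : ℕ → ℝ) (m : ℕ) : ℝ :=
  ∑ i ∈ Finset.range (m + 1),
    (-1) ^ i * (i.factorial : ℝ) * ((ρ 0)⁻¹) ^ i *
      bellP m i (fun j => (j.factorial : ℝ) * ρ j)

/-! ### Partial derivatives in the moment variables. -/

/-- Partial derivative `∂/∂ϱ_l` of a real-valued function of the moments. -/
def pdR (c : (ℕ → ℝ) → ℝ) (l : ℕ) (ρ : ℕ → ℝ) : ℝ :=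
  deriv (fun t => c (Function.update ρ l t)) (ρ l)

/-- Partial derivative `∂/∂ϱ_l` of a complex-valued function of the moments. -/
def pdC (c : (ℕ → ℝ) → ℂ) (l : ℕ) (ρ : ℕ → ℝ) : ℂ :=
  deriv (fun t : ℝ => c (Function.update ρ l t)) (ρ l)

/-! ### Boundary creation operators. -/

/-- Boundary creation operator `Â†_{z_J,w}` with free creation variable `w`, acting on a
family `F` of the moments `ϱ` and boundary variables `(z_i)_{i∈J}`. -/
def AdagFree (J : Finset ℕ) (F : (ℕ → ℝ) → (ℕ → ℂ) → ℂ)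
    (ρ : ℕ → ℝ) (z : ℕ → ℂ) (w : ℂ) : ℂ :=
  (∑' l : ℕ, (-((3 + 2 * (l : ℂ)) * (ρ (l + 1) : ℂ)) / ((ρ 0 : ℂ) * w ^ 3)
      + (3 + 2 * (l : ℂ)) / w ^ (5 + 2 * l)) * pdC (fun σ => F σ z) l ρ)
  + ∑ i ∈ J, (1 / ((ρ 0 : ℂ) * w ^ 3 * z i)) *
      deriv (fun v => F ρ (Function.update z i v)) (z i)

/-- Boundary creation operator creating a boundary at coordinate `p`. -/
def AdagVar (J : Finset ℕ) (p : ℕ) (F : (ℕ → ℝ) → (ℕ → ℂ) → ℂ) :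
    (ℕ → ℝ) → (ℕ → ℂ) → ℂ :=
  fun ρ z => AdagFree J F ρ z (z p)

/-- Boundary creation operator `Â†_w` acting on scalar functions of the moments only. -/
def AdagScalar (F : (ℕ → ℝ) → ℝ) (ρ : ℕ → ℝ) (w : ℂ) : ℂ :=
  ∑' l : ℕ, (-((3 + 2 * (l : ℂ)) * (ρ (l + 1) : ℂ)) / ((ρ 0 : ℂ) * w ^ 3)
      + (3 + 2 * (l : ℂ)) / w ^ (5 + 2 * l)) * (pdR F l ρ : ℂ)

/-! ### The genus recursion for the 1-boundary functions `𝒢_g(z) = Σ_k c_{g,k}(ϱ)/z^{2k+3}`. -/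

/-- Coefficients `e_m(ϱ)` of the even bracket
`w²·(Σ_{h=1}^{g-1} G_h(w)G_{g−h}(w) + (2λ)²·G_{g−1}(w|w))`, expressed through the table
`prev` of the coefficients of the lower-genus one-boundary functions. -/
def eBr (lam : ℝ) (g : ℕ) (prev : ℕ → ℕ → (ℕ → ℝ) → ℝ) (m : ℕ) (ρ : ℕ → ℝ) : ℝ :=
  (∑ h ∈ Finset.Icc 1 (g - 1), ∑ i ∈ Finset.range (m + 1), ∑ j ∈ Finset.range (m + 1),
      if i + j + 2 = m then prev h i ρ * prev (g - h) j ρ else 0)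
  + (2 * lam) ^ 4 *
    ((if 2 ≤ m then
        -(1 / ρ 0) * ∑' l : ℕ, (3 + 2 * (l : ℝ)) * ρ (l + 1) * pdR (prev (g - 1) (m - 2)) l ρ
      else 0)
    + (∑ k ∈ Finset.range (m + 1), ∑ l ∈ Finset.range (m + 1),
        if k + l + 3 = m then (3 + 2 * (l : ℝ)) * pdR (prev (g - 1) k) l ρ else 0)
    + (if 3 ≤ m then -(((2 * (m - 3) + 3 : ℕ) : ℝ) * prev (g - 1) (m - 3) ρ) / ρ 0 else 0))

/-- Table of the coefficients of the one-boundary functions for all genera `h ≤ G`.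
`Gtab lam G h k ρ` is the coefficient of `z^{-(2k+3)}` in `𝒢_h(z)`. -/
def Gtab (lam : ℝ) : ℕ → ℕ → ℕ → (ℕ → ℝ) → ℝ
  | 0 => fun _ _ _ => 0
  | 1 => fun h k ρ =>
      if h = 1 then
        (if k = 0 then 2 * lam ^ 4 * ρ 1 / (ρ 0) ^ 2
         else if k = 1 then -(2 * lam ^ 4) / ρ 0 else 0)
      else 0
  | (G + 2) => fun h k ρ =>
      if h ≤ G + 1 then Gtab lam (G + 1) h k ρ
      else if h = G + 2 then
        -(1 / (2 * ρ 0)) *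
          ∑' j : ℕ, eBr lam (G + 2) (Gtab lam (G + 1)) (k + j) ρ * Sm ρ j / (j.factorial : ℝ)
      else 0

/-- Coefficients of the genus-`g` one-boundary function. -/
def Gcoef (lam : ℝ) (g : ℕ) : ℕ → (ℕ → ℝ) → ℝ := Gtab lam g g

/-- One-boundary function `𝒢_g(z)` of genus `g ≥ 1`. -/
def Gfun (lam : ℝ) (g : ℕ) (ρ : ℕ → ℝ) (z : ℂ) : ℂ :=
  ∑' k : ℕ, (Gcoef lam g k ρ : ℂ) / z ^ (2 * k + 3)

/-- The same-point two-boundary function `𝒢_g(z|z)`, with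
`𝒢₀(z|z) := λ²/z⁴` and `𝒢_g(z|z) := (2λ)²(Â†_z + (1/(ϱ₀z⁴))∂_z)𝒢_g(z)` for `g ≥ 1`. -/
def Gpair (lam : ℝ) (g : ℕ) (ρ : ℕ → ℝ) (z : ℂ) : ℂ :=
  if g = 0 then (lam : ℂ) ^ 2 / z ^ 4
  else (2 * (lam : ℂ)) ^ 2 *
    ((∑' l : ℕ, (-((3 + 2 * (l : ℂ)) * (ρ (l + 1) : ℂ)) / ((ρ 0 : ℂ) * z ^ 3)
        + (3 + 2 * (l : ℂ)) / z ^ (5 + 2 * l)) * pdC (fun σ => Gfun lam g σ z) l ρ)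
     + (1 / ((ρ 0 : ℂ) * z ^ 4)) * deriv (Gfun lam g ρ) z)

/-! ### Multi-boundary functions. -/

/-- Iterated boundary creation for `g ≥ 1` (without prefactors); coordinates `0,…,B−1`. -/
def GBraw (lam : ℝ) (g : ℕ) : ℕ → (ℕ → ℝ) → (ℕ → ℂ) → ℂ
  | 0 => fun _ _ => 0
  | 1 => fun ρ z => Gfun lam g ρ (z 0)
  | (B + 2) => AdagVar (Finset.range (B + 1)) (B + 1) (GBraw lam g (B + 1))

/-- Iterated boundary creation for `g = 0` (without prefactors), starting from `𝒢₀(z₁|z₂)`. -/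
def GBraw0 (lam : ℝ) : ℕ → (ℕ → ℝ) → (ℕ → ℂ) → ℂ
  | 0 => fun _ _ => 0
  | 1 => fun _ _ => 0
  | 2 => fun _ z => 4 * (lam : ℂ) ^ 2 / (z 0 * z 1 * (z 0 + z 1) ^ 2)
  | (B + 3) => AdagVar (Finset.range (B + 2)) (B + 2) (GBraw0 lam (B + 2))

/-- The multi-boundary functions `𝒢_g(z₁|…|z_B)`, with variables at coordinates `0,…,B−1`:
`𝒢_g(z₁|…|z_B) = (2λ)^{3B−4} Â†_{(z₁..z_{B−1}),z_B}(⋯ Â†_{(z₁),z₂}𝒢_g(z₁)⋯)` for `g ≥ 1`,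
and `𝒢₀(z₁|…|z_B) = (2λ)^{3B−6} Â†(⋯ Â†𝒢₀(z₁|z₂)⋯)` for `g = 0`. -/
def GBfun (lam : ℝ) (g B : ℕ) (ρ : ℕ → ℝ) (z : ℕ → ℂ) : ℂ :=
  if g = 0 then (2 * (lam : ℂ)) ^ (3 * B - 6) * GBraw0 lam B ρ z
  else if B = 1 then Gfun lam g ρ (z 0)
  else (2 * (lam : ℂ)) ^ (3 * B - 4) * GBraw lam g B ρ z

/-! ### Free energies and boundary annihilation. -/

/-- Boundary annihilation applied to `𝒢_g`:  `Â_ǎ 𝒢_g = −Σ_l ϱ_l/(3+2l) · c_{g,l+1}(ϱ)`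
(the coefficient of `z^{−5−2l}` in `𝒢_g(z)` is `c_{g,l+1}`). -/
def AcheckG (lam : ℝ) (g : ℕ) (ρ : ℕ → ℝ) : ℝ :=
  -∑' l : ℕ, ρ l / (3 + 2 * (l : ℝ)) * Gcoef lam g (l + 1) ρ

/-- Free energies: `F₁ = −(1/24)·log ϱ₀`, and
`F_g = (1/((2g−2)(2λ)⁴))·Â_ǎ(𝒢_g)` for `g ≥ 2`. -/
def Ffree (lam : ℝ) (g : ℕ) (ρ : ℕ → ℝ) : ℝ :=
  if g = 1 then -(1 / 24) * Real.log (ρ 0)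
  else 1 / ((2 * (g : ℝ) - 2) * (2 * lam) ^ 4) * AcheckG lam g ρ

/-! ### Auxiliary notions. -/

/-- Variable assignment `(z₁, z_{i₁}, z_{i₂}, …)` with first slot `w` and the remaining slots
filled by the coordinates of `z` indexed by the set `I` in increasing order. -/
def slotAt (z : ℕ → ℂ) (w : ℂ) (I : Finset ℕ) : ℕ → ℂ :=
  fun n => if n = 0 then w else z ((I.sort (· ≤ ·)).getD (n - 1) 0)

/-- A polynomial in variables `x₁,…,x_j` is `j`-weighted if each of its monomials
`∏ x_i^{m_i}` satisfies `Σ i·m_i = j`. -/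
def IsWeighted (j : ℕ) (P : MvPolynomial (Fin j) ℚ) : Prop :=
  ∀ m ∈ P.support, (∑ i : Fin j, ((i : ℕ) + 1) * m i) = j

/-- A smooth family `F(ϱ₀,…,ϱ_M; (z_i)_{i∈J})`: it factors through a function of the first
`M+1` moments and the coordinates in `J` which is smooth (and holomorphic in each `z_i`)
on the region `ϱ₀ ≠ 0`, `z_i ≠ 0`. -/
def SmoothFam (M : ℕ) (J : Finset ℕ) (F : (ℕ → ℝ) → (ℕ → ℂ) → ℂ) : Prop :=
  ∃ Ft : ((Fin (M + 1) → ℝ) × ({ i // i ∈ J } → ℂ)) → ℂ,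
    ContDiffOn ℝ (⊤ : ℕ∞) Ft { x | x.1 0 ≠ 0 ∧ ∀ i, x.2 i ≠ 0 } ∧
    (∀ x ∈ ({ x : (Fin (M + 1) → ℝ) × ({ i // i ∈ J } → ℂ) |
        x.1 0 ≠ 0 ∧ ∀ i, x.2 i ≠ 0 }), ∀ i,
      DifferentiableAt ℂ (fun w => Ft (x.1, Function.update x.2 i w)) (x.2 i)) ∧
    ∀ ρ z, F ρ z = Ft (fun l => ρ (l : ℕ), fun i => z (i : ℕ))

/-- A smooth scalar function of `ϱ₀ ≠ 0, ϱ₁, …, ϱ_M`. -/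
def SmoothScalarFam (M : ℕ) (F : (ℕ → ℝ) → ℝ) : Prop :=
  ∃ Ft : (Fin (M + 1) → ℝ) → ℝ,
    ContDiffOn ℝ (⊤ : ℕ∞) Ft { v | v 0 ≠ 0 } ∧ ∀ ρ : ℕ → ℝ, F ρ = Ft (fun l => ρ (l : ℕ))

/-! ### The Laplacian of Theorem `Δ_ϱ`. -/

/-- `R_m(ϱ) = −(2/3) Σ_{k=1}^m (kϱ_k/((3+2k)ϱ₀))·S_{m−k}(ϱ)/(m−k)!`. -/
def Rm (ρ : ℕ → ℝ) (m : ℕ) : ℝ :=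
  -(2 / 3) * ∑ k ∈ Finset.Icc 1 m,
    ((k : ℝ) * ρ k / ((3 + 2 * (k : ℝ)) * ρ 0)) * (Sm ρ (m - k) / ((m - k).factorial : ℝ))

/-- The Laplacian `Δ_ϱ`, acting on functions of the moments. -/
def DeltaRho (F : (ℕ → ℝ) → ℝ) (ρ : ℕ → ℝ) : ℝ :=
  -(-(6 * ρ 1 ^ 3) / (5 * ρ 0 ^ 3) + 111 * ρ 1 * ρ 2 / (70 * ρ 0 ^ 2)
      - ρ 3 / (2 * ρ 0)) * pdR (fun σ => pdR F 0 σ) 0 ρ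
  - (2 * ρ 1 ^ 3 / ρ 0 ^ 4 - 1097 * ρ 1 * ρ 2 / (280 * ρ 0 ^ 3)
      + 41 * ρ 3 / (24 * ρ 0 ^ 2)) * pdR F 0 ρ
  - (∑' k : ℕ, (3 + 2 * ((k : ℝ) + 1)) *
      ((-(2 * ρ 1 ^ 2 / (5 * ρ 0 ^ 3)) + 2 * ρ 2 / (7 * ρ 0 ^ 2)) * ρ (k + 2)
        - 3 * Rm ρ (k + 3) * ρ 1 / (2 * ρ 0) + 3 * Rm ρ (k + 4) / 2) *
      pdR (fun σ => pdR F 0 σ) (k + 1) ρ)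
  - (∑' k : ℕ, ∑' l : ℕ, (3 + 2 * ((k : ℝ) + 1)) * (3 + 2 * ((l : ℝ) + 1)) *
      (-(ρ 1 * ρ (l + 2) * ρ (k + 2) / (30 * ρ 0 ^ 2))
        - ρ (k + 2) * Rm ρ (l + 3) / (4 * ρ 0)
        - ρ (l + 2) * Rm ρ (k + 3) / (4 * ρ 0)
        + Rm ρ (k + l + 5) / 4) *
      pdR (fun σ => pdR F (l + 1) σ) (k + 1) ρ)
  - (∑' k : ℕ, (3 + 2 * ((k : ℝ) + 1)) *
      ((19 * ρ 1 ^ 2 / (60 * ρ 0 ^ 4) - 25 * ρ 2 / (84 * ρ 0 ^ 3)) * ρ (k + 2)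
        + ρ 1 * Rm ρ (k + 3) / (16 * ρ 0 ^ 2)
        - Rm ρ (k + 4) / (16 * ρ 0)
        - (5 + 2 * ((k : ℝ) + 1)) * ρ 1 * ρ (k + 3) / (30 * ρ 0 ^ 3)
        - (5 + 2 * ((k : ℝ) + 1)) * Rm ρ (k + 4) / (2 * ρ 0)) *
      pdR F (k + 1) ρ)

/-- The operator `D = −(2λ)⁴Δ_ϱ + (2λ)⁴·(−21ϱ₁³/(160ϱ₀⁵)+29ϱ₁ϱ₂/(128ϱ₀⁴)−35ϱ₃/(384ϱ₀³))·`. -/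
def Dop (lam : ℝ) (F : (ℕ → ℝ) → ℝ) : (ℕ → ℝ) → ℝ :=
  fun ρ => -(2 * lam) ^ 4 * DeltaRho F ρ
    + (2 * lam) ^ 4 * (-(21 / 160) * ρ 1 ^ 3 / ρ 0 ^ 5 + (29 / 128) * ρ 1 * ρ 2 / ρ 0 ^ 4
        - (35 / 384) * ρ 3 / ρ 0 ^ 3) * F ρ

end NCQFT

theorem bracket_aux (z y : ℂ) (hz : z ≠ 0) (hy : y ≠ 0) (h1 : z + y ≠ 0) (h2 : z - y ≠ 0) (n : ℕ) :
    1 / ((z + y) * y) * (1 / z ^ (3 + 2 * n)) + (1 / z ^ (3 + 2 * n) - 1 / y ^ (3 + 2 * n)) / (z ^ 2 - y ^ 2)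
      = -∑ k ∈ Finset.range (n + 1), 1 / y ^ (3 + 2 * k) / z ^ (2 * n + 2 - 2 * k) := by
  have h3 : z ^ 2 - y ^ 2 = (z + y) * (z - y) := by ring
  rw [h3]
  induction n with
  | zero =>
    simp
    field_simp
    ring
  | succ n ih =>
    have e : ∑ k ∈ Finset.range (n + 1), 1 / y ^ (3 + 2 * k) / z ^ (2 * (n + 1) + 2 - 2 * k)
        = (∑ k ∈ Finset.range (n + 1), 1 / y ^ (3 + 2 * k) / z ^ (2 * n + 2 - 2 * k)) / z ^ 2 := by
      rw [Finset.sum_div]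
      refine Finset.sum_congr rfl fun k hk => ?_
      have hk' := Finset.mem_range.mp hk
      have : 2 * (n + 1) + 2 - 2 * k = (2 * n + 2 - 2 * k) + 2 := by omega
      rw [this, pow_add z _ 2, div_div _ _ (z ^ 2)]
    rw [Finset.sum_range_succ, e, ← neg_eq_iff_eq_neg.mpr ih]
    have : 2 * (n + 1) + 2 - 2 * (n + 1) = 2 := by omega
    rw [this]
    have e1 : 3 + 2 * (n + 1) = (3 + 2 * n) + 2 := by ring
    rw [e1, pow_add z (3 + 2 * n) 2, pow_add y (3 + 2 * n) 2]
    have hzn : z ^ (3 + 2 * n) ≠ 0 := pow_ne_zero _ hz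
    have hyn : y ^ (3 + 2 * n) ≠ 0 := pow_ne_zero _ hy
    generalize z ^ (3 + 2 * n) = A at *
    generalize y ^ (3 + 2 * n) = B at *
    field_simp
    ring

open NCQFT in
/-- For every admissible `z`, `K̂(1/y)(z) = s` and
`K̂(1/y^{3+2n})(z) = Σ_{k=0}^n ϱ_k/z^{2n+2−2k}`. -/
theorem stmt0 (a b s nbar : ℝ) (r : ℝ → ℝ)
    (ha : 0 < a) (hab : a < b)
    (hr : ContinuousOn r (Set.Icc a b)) (hrpos : ∀ y ∈ Set.Icc a b, 0 ≤ r y)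
    (hs : 0 < s) (z : ℂ) (hz : Admissible a b z) :
    Khat a b s nbar r (fun y => 1 / y) z = (s : ℂ) ∧
    ∀ n : ℕ, Khat a b s nbar r (fun y => 1 / y ^ (3 + 2 * n)) z
      = ∑ k ∈ Finset.range (n + 1), (moment a b s r k : ℂ) / z ^ (2 * n + 2 - 2 * k) := by
  obtain ⟨hz0, hz⟩ := hz
  have hu : Set.uIcc a b = Set.Icc a b := Set.uIcc_of_le hab.le
  have hy0 : ∀ y ∈ Set.uIcc a b, (y : ℂ) ≠ 0 := fun y hy => by
    rw [hu] at hy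
    exact_mod_cast (ha.trans_le hy.1).ne'
  have hp : ∀ y ∈ Set.uIcc a b, z + (y : ℂ) ≠ 0 := fun y hy h => by
    rw [hu] at hy
    exact (hz y hy).2 (eq_neg_of_add_eq_zero_left h)
  have hm : ∀ y ∈ Set.uIcc a b, z - (y : ℂ) ≠ 0 := fun y hy h => by
    rw [hu] at hy
    exact (hz y hy).1 (sub_eq_zero.mp h)
  have hsq : ∀ y ∈ Set.uIcc a b, z ^ 2 - (y : ℂ) ^ 2 ≠ 0 := fun y hy => by
    rw [sq_sub_sq]
    exact mul_ne_zero (hp y hy) (hm y hy)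
  have hrc : ContinuousOn (fun y : ℝ => (r y : ℂ)) (Set.uIcc a b) := by
    rw [hu]
    exact Complex.continuous_ofReal.comp_continuousOn hr
  have hc : ContinuousOn (fun y : ℝ => (y : ℂ)) (Set.uIcc a b) :=
    Complex.continuous_ofReal.continuousOn
  have i1 : IntervalIntegrable (fun y : ℝ => (r y : ℂ) / ((z + (y : ℂ)) * (y : ℂ))) volume a b :=
    (hrc.div ((continuousOn_const.add hc).mul hc)
      fun y hy => mul_ne_zero (hp y hy) (hy0 y hy)).intervalIntegrable
  have i2 : ∀ m : ℕ, IntervalIntegrable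
      (fun y : ℝ => (r y : ℂ) * (1 / z ^ m - 1 / (y : ℂ) ^ m) / (z ^ 2 - (y : ℂ) ^ 2))
      volume a b := fun m =>
    ((hrc.mul (continuousOn_const.sub (continuousOn_const.div (hc.pow m)
      fun y hy => pow_ne_zero _ (hy0 y hy)))).div (continuousOn_const.sub (hc.pow 2))
      hsq).intervalIntegrable
  have i3 : ∀ m : ℕ, IntervalIntegrable (fun y : ℝ => (r y : ℂ) / (y : ℂ) ^ m) volume a b :=
    fun m => (hrc.div (hc.pow m) fun y hy => pow_ne_zero _ (hy0 y hy)).intervalIntegrable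
  have key : ∀ m : ℕ, Khat a b s nbar r (fun y => 1 / y ^ m) z = s * z / z ^ m
      + 1 / 2 * ∫ y in a..b, (r y : ℂ) * (1 / ((z + y) * y) * (1 / z ^ m)
        + (1 / z ^ m - 1 / (y : ℂ) ^ m) / (z ^ 2 - (y : ℂ) ^ 2)) := by
    intro m
    have : (∫ y in a..b, (r y : ℂ) * (1 / ((z + y) * y) * (1 / z ^ m)
        + (1 / z ^ m - 1 / (y : ℂ) ^ m) / (z ^ 2 - (y : ℂ) ^ 2)))
        = (∫ y in a..b, (r y : ℂ) / ((z + (y : ℂ)) * (y : ℂ))) * (1 / z ^ m)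
          + ∫ y in a..b, (r y : ℂ) * (1 / z ^ m - 1 / (y : ℂ) ^ m) / (z ^ 2 - (y : ℂ) ^ 2) := by
      rw [← intervalIntegral.integral_mul_const,
        ← intervalIntegral.integral_add (i1.mul_const _) (i2 m)]
      refine intervalIntegral.integral_congr fun y _ => ?_
      ring
    rw [this]
    simp only [Khat, G0fun]
    ring
  constructor
  · have h := key 1
    simp only [pow_one] at h
    rw [h, mul_div_cancel_right₀ _ hz0]
    have : (∫ y in a..b, (r y : ℂ) * (1 / ((z + y) * y) * (1 / z)
        + (1 / z - 1 / (y : ℂ)) / (z ^ 2 - (y : ℂ) ^ 2))) = ∫ y in a..b, (0 : ℂ) := by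
      refine intervalIntegral.integral_congr fun y hy => ?_
      have h1 := hp y hy
      have h2 := hm y hy
      have h3 := hy0 y hy
      simp only [sq_sub_sq]
      field_simp
      ring
    rw [this]
    simp
  · intro n
    rw [key]
    have hmom : ∀ k, (moment a b s r k : ℂ)
        = (if k = 0 then (s : ℂ) else 0) - 1 / 2 * ∫ y in a..b, (r y : ℂ) / (y : ℂ) ^ (3 + 2 * k) := by
      intro k
      have : (∫ y in a..b, (r y : ℂ) / (y : ℂ) ^ (3 + 2 * k))
          = ((∫ y in a..b, r y / y ^ (3 + 2 * k) : ℝ) : ℂ) := by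
        rw [← intervalIntegral.integral_ofReal]
        refine intervalIntegral.integral_congr fun y _ => ?_
        push_cast
        rfl
      rw [this, moment]
      push_cast
      split_ifs <;> simp
    have hI : (∫ y in a..b, (r y : ℂ) * (1 / ((z + y) * y) * (1 / z ^ (3 + 2 * n))
        + (1 / z ^ (3 + 2 * n) - 1 / (y : ℂ) ^ (3 + 2 * n)) / (z ^ 2 - (y : ℂ) ^ 2)))
        = -∑ k ∈ Finset.range (n + 1),
          (∫ y in a..b, (r y : ℂ) / (y : ℂ) ^ (3 + 2 * k)) / z ^ (2 * n + 2 - 2 * k) := by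
      simp_rw [← intervalIntegral.integral_div]
      rw [← intervalIntegral.integral_finsetSum fun k _ => (i3 (3 + 2 * k)).div_const _,
        ← intervalIntegral.integral_neg]
      refine intervalIntegral.integral_congr fun y hy => ?_
      rw [bracket_aux z y hz0 (hy0 y hy) (hp y hy) (hm y hy), mul_neg, Finset.mul_sum]
      congr 1
      refine Finset.sum_congr rfl fun k _ => ?_
      ring
    rw [hI]
    simp_rw [hmom, sub_div, Finset.sum_sub_distrib]
    have hS : ∑ k ∈ Finset.range (n + 1), (if k = 0 then (s : ℂ) else 0) / z ^ (2 * n + 2 - 2 * k)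
        = s * z / z ^ (3 + 2 * n) := by
      rw [Finset.sum_eq_single 0 (fun k _ hk => by simp [hk]) (fun h => by simp at h)]
      have : 3 + 2 * n = (2 * n + 2) + 1 := by ring
      rw [this, pow_succ, mul_div_mul_right _ _ hz0]
      simp
    rw [hS]
    simp_rw [mul_div_assoc, ← Finset.mul_sum]
    ring
end
end

section
/- Boundary creation operators commute: for a finite index set J, distinct indices p, q ∉ J, and every smooth function F of the variables ϱ₀ ≠ 0, ϱ₁, …, ϱ_M and (z_i)_{i∈J} (all z_i ≠ 0), one has Â†_{z_{J∪{p}},z_q}(Â†_{z_J,z_p}F) = Â†_{z_{J∪{q}},z_p}(Â†_{z_J,z_q}F) at all points with z_p ≠ 0 and z_q ≠ 0. -/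
open scoped BigOperators
open MeasureTheory

noncomputable section

namespace NCQFT

/-! ### Helper material for the proof. -/

section Helpers

variable {M : ℕ} {J : Finset ℕ}

/-- The finite-dimensional space of variables. -/
abbrev EE (M : ℕ) (J : Finset ℕ) : Type := (Fin (M + 1) → ℝ) × ({ i // i ∈ J } → ℂ)

/-- Domain. -/
def dom (M : ℕ) (J : Finset ℕ) : Set (EE M J) := { x | x.1 0 ≠ 0 ∧ ∀ i, x.2 i ≠ 0 }

/-- Projection to the finitely many variables. -/
def pr (M : ℕ) (J : Finset ℕ) (ρ : ℕ → ℝ) (z : ℕ → ℂ) : EE M J :=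
  (fun l => ρ (l : ℕ), fun i => z (i : ℕ))

/-- Unit vector in moment direction. -/
def uu (M : ℕ) (J : Finset ℕ) (l : ℕ) : EE M J :=
  (fun k => if (k : ℕ) = l then 1 else 0, 0)

/-- Embedding of the complex line in direction `i`. -/
def vL (M : ℕ) (J : Finset ℕ) (i : ℕ) : ℂ →L[ℝ] EE M J :=
  (ContinuousLinearMap.inr ℝ (Fin (M + 1) → ℝ) ({ i // i ∈ J } → ℂ)).comp
    (ContinuousLinearMap.pi fun k => if (k : ℕ) = i then ContinuousLinearMap.id ℝ ℂ else 0)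

lemma uu_zero {l : ℕ} (h : M + 1 ≤ l) : uu M J l = 0 := by
  unfold uu
  ext k
  · have := k.2
    have h' : (k : ℕ) ≠ l := by omega
    simp [h']
  · rfl

lemma vL_zero {i : ℕ} (h : i ∉ J) : vL M J i = 0 := by
  ext c k
  · simp [vL]
  · have h' : (k : ℕ) ≠ i := fun e => h (e ▸ k.2)
    simp [vL, h']

lemma pr_update_left (ρ : ℕ → ℝ) (z : ℕ → ℂ) (l : ℕ) (t : ℝ) :
    pr M J (Function.update ρ l t) z = pr M J ρ z + (t - ρ l) • uu M J l := by
  unfold pr uu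
  refine Prod.ext ?_ ?_
  · funext k
    by_cases h : (k : ℕ) = l
    · subst h; simp
    · simp [h]
  · simp

lemma pr_update_right (ρ : ℕ → ℝ) (z : ℕ → ℂ) (i : ℕ) (w : ℂ) :
    pr M J ρ (Function.update z i w) = pr M J ρ z + vL M J i (w - z i) := by
  unfold pr vL
  refine Prod.ext ?_ ?_
  · simp
  · funext k
    by_cases h : (k : ℕ) = i
    · subst h; simp
    · simp [h]

lemma dom_open : IsOpen (dom M J) := by
  unfold dom
  have h1 : IsOpen {x : EE M J | x.1 0 ≠ 0} :=
    isOpen_ne_fun (by fun_prop) continuous_const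
  have h2 : ∀ i, IsOpen {x : EE M J | x.2 i ≠ 0} := fun i =>
    isOpen_ne_fun (by fun_prop) continuous_const
  have := h1.inter (isOpen_iInter_of_finite h2)
  convert this using 1
  ext x; simp

lemma pr_mem {ρ : ℕ → ℝ} {z : ℕ → ℂ} (h0 : ρ 0 ≠ 0) (hz : ∀ i ∈ J, z i ≠ 0) :
    pr M J ρ z ∈ dom M J := ⟨by simpa [pr] using h0, fun i => hz i i.2⟩

lemma path_real {g : EE M J → ℂ} {g' : EE M J →L[ℝ] ℂ} {ρ : ℕ → ℝ} {z : ℕ → ℂ}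
    (h : HasFDerivAt g g' (pr M J ρ z)) (l : ℕ) :
    HasDerivAt (fun t : ℝ => g (pr M J (Function.update ρ l t) z)) (g' (uu M J l)) (ρ l) := by
  have hc : HasDerivAt (fun t : ℝ => pr M J (Function.update ρ l t) z) (uu M J l) (ρ l) := by
    simp only [pr_update_left]
    have := (((hasDerivAt_id (ρ l)).sub_const (ρ l)).smul_const (uu M J l)).const_add
      (pr M J ρ z)
    simpa using this
  have h' : HasFDerivAt g g' (pr M J (Function.update ρ l (ρ l)) z) := by
    simpa [Function.update_eq_self] using h
  exact h'.comp_hasDerivAt (ρ l) hc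

lemma aff_deriv (L : ℂ →L[ℝ] EE M J) (x : EE M J) (c : ℂ) :
    HasFDerivAt (fun w : ℂ => x + L (w - c)) L c := by
  simp only [map_sub]
  exact ((L.hasFDerivAt (x := c)).sub_const (L c)).const_add x

lemma path_cplxR {g : EE M J → ℂ} {g' : EE M J →L[ℝ] ℂ} {ρ : ℕ → ℝ} {z : ℕ → ℂ}
    (h : HasFDerivAt g g' (pr M J ρ z)) (i : ℕ) :
    HasFDerivAt (fun w : ℂ => g (pr M J ρ (Function.update z i w))) (g'.comp (vL M J i))
      (z i) := by
  have hc : HasFDerivAt (fun w : ℂ => pr M J ρ (Function.update z i w)) (vL M J i) (z i) := by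
    simp only [pr_update_right]
    exact aff_deriv _ _ _
  have h' : HasFDerivAt g g' (pr M J ρ (Function.update z i (z i))) := by
    simpa [Function.update_eq_self] using h
  exact h'.comp (z i) hc

lemma path_cplx {g : EE M J → ℂ} {g' : EE M J →L[ℝ] ℂ} {ρ : ℕ → ℝ} {z : ℕ → ℂ}
    (h : HasFDerivAt g g' (pr M J ρ z)) (i : ℕ)
    (hI : g' (vL M J i Complex.I) = Complex.I * g' (vL M J i 1)) :
    HasDerivAt (fun w : ℂ => g (pr M J ρ (Function.update z i w))) (g' (vL M J i 1)) (z i) := by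
  have h1 := path_cplxR h i
  have h2 : HasFDerivAt (fun w : ℂ => g (pr M J ρ (Function.update z i w)))
      (ContinuousLinearMap.toSpanSingleton ℂ (g' (vL M J i 1))) (z i) := by
    refine hasFDerivAt_of_restrictScalars ℝ h1 ?_
    ext c
    have hc : c = c.re • (1 : ℂ) + c.im • Complex.I := by
      simp [Complex.re_add_im]
    have : g' (vL M J i c) = c * g' (vL M J i 1) := by
      conv_lhs => rw [hc]
      simp only [map_add, map_smul, hI]
      simp only [Complex.real_smul]
      conv_rhs => rw [← Complex.re_add_im c]
      ring
    simp [this]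
  simpa using h2.hasDerivAt

/-- Analytic data of the function. -/
structure Good (Ft : EE M J → ℂ) : Prop where
  smooth : ContDiffOn ℝ (⊤ : ℕ∞) Ft (dom M J)
  holo : ∀ x ∈ dom M J, ∀ i,
      DifferentiableAt ℂ (fun w => Ft (x.1, Function.update x.2 i w)) (x.2 i)

variable {Ft : EE M J → ℂ}

lemma Good.cda (hG : Good Ft) {x : EE M J} (hx : x ∈ dom M J) :
    ContDiffAt ℝ (⊤ : ℕ∞) Ft x := hG.smooth.contDiffAt (dom_open.mem_nhds hx)

lemma Good.hasD (hG : Good Ft) {x : EE M J} (hx : x ∈ dom M J) :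
    HasFDerivAt Ft (fderiv ℝ Ft x) x :=
  ((hG.cda hx).differentiableAt (by simp)).hasFDerivAt

lemma Good.hasD2 (hG : Good Ft) {x : EE M J} (hx : x ∈ dom M J) :
    HasFDerivAt (fderiv ℝ Ft) (fderiv ℝ (fderiv ℝ Ft) x) x := by
  have : ContDiffAt ℝ 1 (fderiv ℝ Ft) x :=
    (hG.cda hx).fderiv_right (m := 1) (by norm_cast)
  exact (this.differentiableAt (by simp)).hasFDerivAt

lemma Good.symm (hG : Good Ft) {x : EE M J} (hx : x ∈ dom M J) (y y' : EE M J) :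
    fderiv ℝ (fderiv ℝ Ft) x y y' = fderiv ℝ (fderiv ℝ Ft) x y' y := by
  have : IsSymmSndFDerivAt ℝ Ft x := (hG.cda hx).isSymmSndFDerivAt (by simp; norm_cast)
  exact this y y'

lemma Good.CR (hG : Good Ft) {x : EE M J} (hx : x ∈ dom M J) (i : ℕ) :
    fderiv ℝ Ft x (vL M J i Complex.I) = Complex.I * fderiv ℝ Ft x (vL M J i 1) := by
  by_cases hi : i ∈ J
  · have h1 := (hG.holo x hx ⟨i, hi⟩).hasDerivAt.hasFDerivAt.restrictScalars ℝ
    have hc : HasFDerivAt (fun w : ℂ => x + vL M J i (w - x.2 ⟨i, hi⟩)) (vL M J i)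
        (x.2 ⟨i, hi⟩) := aff_deriv _ _ _
    have h2 : HasFDerivAt Ft (fderiv ℝ Ft x)
        (x + vL M J i (x.2 ⟨i, hi⟩ - x.2 ⟨i, hi⟩)) := by
      simpa using hG.hasD hx
    have h3 := h2.comp (x.2 ⟨i, hi⟩) hc
    have he : (Ft ∘ fun w : ℂ => x + vL M J i (w - x.2 ⟨i, hi⟩))
        = fun w => Ft (x.1, Function.update x.2 ⟨i, hi⟩ w) := by
      funext w
      simp only [Function.comp]
      congr 1
      refine Prod.ext ?_ ?_
      · simp [vL]
      · funext k
        by_cases h : k = ⟨i, hi⟩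
        · subst h; simp [vL]
        · have h' : (k : ℕ) ≠ i := fun e => h (Subtype.ext e)
          simp [vL, h, h']
    rw [he] at h3
    have h4 := h3.unique h1
    have hI := congrArg (fun L => L Complex.I) h4
    have h1' := congrArg (fun L => L (1 : ℂ)) h4
    simp only [ContinuousLinearMap.comp_apply] at hI h1'
    rw [hI, h1']
    simp
  · simp [vL_zero hi]

lemma Good.CR2 (hG : Good Ft) {x : EE M J} (hx : x ∈ dom M J) (i : ℕ) (y : EE M J) :
    fderiv ℝ (fderiv ℝ Ft) x (vL M J i Complex.I) y
      = Complex.I * fderiv ℝ (fderiv ℝ Ft) x (vL M J i 1) y := by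
  rw [hG.symm hx, hG.symm hx (vL M J i 1) y]
  have h1 := (hG.hasD2 hx).clm_apply (hasFDerivAt_const (vL M J i Complex.I) x)
  have h2 := ((hG.hasD2 hx).clm_apply (hasFDerivAt_const (vL M J i (1 : ℂ)) x)).const_mul
    Complex.I
  have h3 := h1.congr_of_eventuallyEq (f₁ := fun x' => Complex.I * fderiv ℝ Ft x' (vL M J i 1)) (by
    filter_upwards [dom_open.mem_nhds hx] with x' hx'
    exact (hG.CR hx' i).symm)
  have h4 := congrArg (fun L => L y) (h3.unique h2)
  simpa using h4

/-- Second derivative applied: as a derivative of `x ↦ D x y`. -/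
lemma Good.hasDy (hG : Good Ft) {x : EE M J} (hx : x ∈ dom M J) (y : EE M J) :
    HasFDerivAt (fun x' => fderiv ℝ Ft x' y) ((fderiv ℝ (fderiv ℝ Ft) x).flip y) x := by
  have h1 := (hG.hasD2 hx).clm_apply (hasFDerivAt_const y x)
  have he : (fderiv ℝ Ft x).comp (0 : EE M J →L[ℝ] EE M J)
      + (fderiv ℝ (fderiv ℝ Ft) x).flip y = (fderiv ℝ (fderiv ℝ Ft) x).flip y := by
    simp
  exact he ▸ h1

lemma Good.d2_real (hG : Good Ft) {ρ : ℕ → ℝ} {z : ℕ → ℂ} (h : pr M J ρ z ∈ dom M J)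
    (y : EE M J) (l : ℕ) :
    HasDerivAt (fun t : ℝ => fderiv ℝ Ft (pr M J (Function.update ρ l t) z) y)
      (fderiv ℝ (fderiv ℝ Ft) (pr M J ρ z) (uu M J l) y) (ρ l) :=
  path_real (hG.hasDy h y) l

lemma Good.d2_cplx (hG : Good Ft) {ρ : ℕ → ℝ} {z : ℕ → ℂ} (h : pr M J ρ z ∈ dom M J)
    (y : EE M J) (i : ℕ) :
    HasDerivAt (fun w : ℂ => fderiv ℝ Ft (pr M J ρ (Function.update z i w)) y)
      (fderiv ℝ (fderiv ℝ Ft) (pr M J ρ z) (vL M J i 1) y) (z i) :=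
  path_cplx (hG.hasDy h y) i (hG.CR2 h i y)

/-- Coefficient of `∂/∂ϱ_l`. -/
def ca (ρ : ℕ → ℝ) (w : ℂ) (l : ℕ) : ℂ :=
  -((3 + 2 * (l : ℂ)) * (ρ (l + 1) : ℂ)) / ((ρ 0 : ℂ) * w ^ 3)
      + (3 + 2 * (l : ℂ)) / w ^ (5 + 2 * l)

/-- Coefficient of `∂/∂z_i`. -/
def cb (ρ : ℕ → ℝ) (w zi : ℂ) : ℂ := 1 / ((ρ 0 : ℂ) * w ^ 3 * zi)

/-- The operator applied once. -/
lemma first_apply {F : (ℕ → ℝ) → (ℕ → ℂ) → ℂ} (hG : Good Ft)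
    (hF : ∀ ρ z, F ρ z = Ft (pr M J ρ z)) {ρ : ℕ → ℝ} {z : ℕ → ℂ}
    (h : pr M J ρ z ∈ dom M J) (p : ℕ) :
    AdagVar J p F ρ z = (∑ m ∈ Finset.range (M + 1),
        ca ρ (z p) m * fderiv ℝ Ft (pr M J ρ z) (uu M J m))
      + ∑ i ∈ J, cb ρ (z p) (z i) * fderiv ℝ Ft (pr M J ρ z) (vL M J i 1) := by
  have h1 : ∀ l, pdC (fun σ => F σ z) l ρ = fderiv ℝ Ft (pr M J ρ z) (uu M J l) := by
    intro l
    simp only [pdC, hF]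
    exact (path_real (hG.hasD h) l).deriv
  have h2 : ∀ i, deriv (fun v => F ρ (Function.update z i v)) (z i)
      = fderiv ℝ Ft (pr M J ρ z) (vL M J i 1) := by
    intro i
    simp only [hF]
    exact (path_cplx (hG.hasD h) i (hG.CR h i)).deriv
  unfold AdagVar AdagFree
  simp only [h1, h2]
  congr 1
  apply tsum_eq_sum
  intro l hl
  rw [uu_zero (by simpa using hl)]
  simp


/-- Derivative of `ca` in `ϱ_l`. -/
def da (ρ : ℕ → ℝ) (w : ℂ) (l m : ℕ) : ℂ :=
  (if l = 0 then (3 + 2 * (m : ℂ)) * (ρ (m + 1) : ℂ) / ((ρ 0 : ℂ) ^ 2 * w ^ 3) else 0)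
    + (if l = m + 1 then -(3 + 2 * (m : ℂ)) / ((ρ 0 : ℂ) * w ^ 3) else 0)

/-- Derivative of `cb` in `ϱ_l`. -/
def db (ρ : ℕ → ℝ) (w zi : ℂ) (l : ℕ) : ℂ :=
  if l = 0 then -1 / ((ρ 0 : ℂ) ^ 2 * w ^ 3 * zi) else 0

/-- Derivative of `ca` in `w`. -/
def wa (ρ : ℕ → ℝ) (w : ℂ) (m : ℕ) : ℂ :=
  (3 + 2 * (m : ℂ)) * (3 * (ρ (m + 1) : ℂ) / ((ρ 0 : ℂ) * w ^ 4)
    - (5 + 2 * (m : ℂ)) / w ^ (6 + 2 * m))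

/-- Derivative of `cb` in `w`. -/
def wb (ρ : ℕ → ℝ) (w zi : ℂ) : ℂ := -3 / ((ρ 0 : ℂ) * w ^ 4 * zi)

/-- Derivative of `cb` in `zi`. -/
def zb (ρ : ℕ → ℝ) (w zi : ℂ) : ℂ := -1 / ((ρ 0 : ℂ) * w ^ 3 * zi ^ 2)

lemma upd_deriv (ρ : ℕ → ℝ) (l k : ℕ) :
    HasDerivAt (fun t : ℝ => ((Function.update ρ l t k : ℝ) : ℂ)) (if l = k then 1 else 0)
      (ρ l) := by
  by_cases h : l = k
  · subst h
    simpa using (hasDerivAt_id (ρ l)).ofReal_comp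
  · have h' : k ≠ l := fun e => h e.symm
    simp only [h, if_false, Function.update_of_ne h']
    exact hasDerivAt_const _ _

lemma ca_rho {ρ : ℕ → ℝ} (h0 : ρ 0 ≠ 0) {w : ℂ} (hw : w ≠ 0) (l m : ℕ) :
    HasDerivAt (fun t : ℝ => ca (Function.update ρ l t) w m) (da ρ w l m) (ρ l) := by
  have h0' : (ρ 0 : ℂ) ≠ 0 := by exact_mod_cast h0
  unfold ca
  have h1 := ((upd_deriv ρ l (m + 1)).const_mul (3 + 2 * (m : ℂ))).neg
  have h2 := (upd_deriv ρ l 0).mul_const (w ^ 3)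
  have h3 := (h1.div h2 (by simp [h0', hw])).add_const ((3 + 2 * (m : ℂ)) / w ^ (5 + 2 * m))
  refine h3.congr_deriv ?_
  simp only [Function.update_eq_self, da]
  by_cases hl : l = 0
  · subst hl
    simp
    field_simp
  · by_cases hl' : l = m + 1
    · subst hl'
      simp
      field_simp
    · simp [hl, hl']

lemma cb_rho {ρ : ℕ → ℝ} (h0 : ρ 0 ≠ 0) {w zi : ℂ} (hw : w ≠ 0) (hz : zi ≠ 0) (l : ℕ) :
    HasDerivAt (fun t : ℝ => cb (Function.update ρ l t) w zi) (db ρ w zi l) (ρ l) := by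
  have h0' : (ρ 0 : ℂ) ≠ 0 := by exact_mod_cast h0
  unfold cb
  have h2 := ((upd_deriv ρ l 0).mul_const (w ^ 3)).mul_const zi
  have h3 := (hasDerivAt_const (ρ l) (1 : ℂ)).div h2 (by simp [h0', hw, hz])
  refine h3.congr_deriv ?_
  simp only [Function.update_eq_self, db]
  by_cases hl : l = 0
  · subst hl
    simp
    field_simp
  · simp [hl]

lemma ca_w {ρ : ℕ → ℝ} (h0 : ρ 0 ≠ 0) {w : ℂ} (hw : w ≠ 0) (m : ℕ) :
    HasDerivAt (fun v : ℂ => ca ρ v m) (wa ρ w m) w := by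
  have h0' : (ρ 0 : ℂ) ≠ 0 := by exact_mod_cast h0
  unfold ca
  have h1 := (hasDerivAt_const w (-((3 + 2 * (m : ℂ)) * (ρ (m + 1) : ℂ)))).div
    ((hasDerivAt_pow 3 w).const_mul (ρ 0 : ℂ)) (by simp [h0', hw])
  have h2 := (hasDerivAt_const w (3 + 2 * (m : ℂ))).div (hasDerivAt_pow (5 + 2 * m) w)
    (by simp [hw])
  refine (h1.add h2).congr_deriv ?_
  have e1 : 5 + 2 * m - 1 = 4 + 2 * m := by omega
  simp only [wa, e1, pow_add]
  push_cast
  field_simp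
  ring

lemma cb_w {ρ : ℕ → ℝ} (h0 : ρ 0 ≠ 0) {w zi : ℂ} (hw : w ≠ 0) (hz : zi ≠ 0) :
    HasDerivAt (fun v : ℂ => cb ρ v zi) (wb ρ w zi) w := by
  have h0' : (ρ 0 : ℂ) ≠ 0 := by exact_mod_cast h0
  unfold cb
  have h1 := (hasDerivAt_const w (1 : ℂ)).div
    (((hasDerivAt_pow 3 w).const_mul (ρ 0 : ℂ)).mul_const zi) (by simp [h0', hw, hz])
  refine h1.congr_deriv ?_
  simp only [wb]
  field_simp
  push_cast
  ring

lemma cb_z {ρ : ℕ → ℝ} (h0 : ρ 0 ≠ 0) {w zi : ℂ} (hw : w ≠ 0) (hz : zi ≠ 0) :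
    HasDerivAt (fun v : ℂ => cb ρ w v) (zb ρ w zi) zi := by
  have h0' : (ρ 0 : ℂ) ≠ 0 := by exact_mod_cast h0
  unfold cb
  have h1 := (hasDerivAt_const zi (1 : ℂ)).div
    ((hasDerivAt_id zi).const_mul ((ρ 0 : ℂ) * w ^ 3)) (by simp [h0', hw, hz])
  refine h1.congr_deriv ?_
  simp only [zb]
  simp
  field_simp

/-- First-order coefficient in `ϱ_m`. -/
def Cm (ρ : ℕ → ℝ) (p q : ℂ) (m : ℕ) : ℂ :=
  (3 + 2 * (m : ℂ)) * (-3 * (ρ 1 : ℂ) * (ρ (m + 1) : ℂ) / ((ρ 0 : ℂ) ^ 3 * p ^ 3 * q ^ 3)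
    + 3 * (ρ (m + 1) : ℂ) / ((ρ 0 : ℂ) ^ 2) * (1 / (p ^ 3 * q ^ 5) + 1 / (p ^ 5 * q ^ 3))
    + (5 + 2 * (m : ℂ)) * (ρ (m + 2) : ℂ) / ((ρ 0 : ℂ) ^ 2 * p ^ 3 * q ^ 3)
    - (5 + 2 * (m : ℂ)) / (ρ 0 : ℂ)
      * (1 / (p ^ 3 * q ^ (7 + 2 * m)) + 1 / (p ^ (7 + 2 * m) * q ^ 3)))

/-- First-order coefficient in `z_i`. -/
def Ci (ρ : ℕ → ℝ) (p q zi : ℂ) : ℂ :=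
  3 * (ρ 1 : ℂ) / ((ρ 0 : ℂ) ^ 3 * p ^ 3 * q ^ 3 * zi)
    - 3 / ((ρ 0 : ℂ) ^ 2 * zi) * (1 / (p ^ 3 * q ^ 5) + 1 / (p ^ 5 * q ^ 3))
    - 1 / ((ρ 0 : ℂ) ^ 2 * p ^ 3 * q ^ 3 * zi ^ 3)

lemma Cm_comm (ρ : ℕ → ℝ) (p q : ℂ) (m : ℕ) : Cm ρ p q m = Cm ρ q p m := by
  unfold Cm; ring

lemma Ci_comm (ρ : ℕ → ℝ) (p q zi : ℂ) : Ci ρ p q zi = Ci ρ q p zi := by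
  unfold Ci; ring

lemma Cm_eq {ρ : ℕ → ℝ} (h0 : ρ 0 ≠ 0) {p q : ℂ} (hp : p ≠ 0) (hq : q ≠ 0) {N m : ℕ}
    (hm : m ∈ Finset.range N) :
    (∑ l ∈ Finset.range (N + 1), ca ρ q l * da ρ p l m) + cb ρ q p * wa ρ p m
      = Cm ρ p q m := by
  have h0' : (ρ 0 : ℂ) ≠ 0 := by exact_mod_cast h0
  have hm' : m < N := by simpa using hm
  simp only [da, mul_add, Finset.sum_add_distrib, mul_ite, mul_zero, Finset.sum_ite_eq',
    Finset.mem_range]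
  rw [if_pos (by omega), if_pos (by omega)]
  simp only [ca, cb, wa, Cm]
  have e : 5 + 2 * (m + 1) = 7 + 2 * m := by ring
  rw [e]
  simp only [pow_add]
  push_cast
  field_simp
  ring

lemma Ci_eq {ρ : ℕ → ℝ} (h0 : ρ 0 ≠ 0) {p q zi : ℂ} (hp : p ≠ 0) (hq : q ≠ 0) (hz : zi ≠ 0)
    (N : ℕ) :
    (∑ l ∈ Finset.range (N + 1), ca ρ q l * db ρ p zi l) + cb ρ q zi * zb ρ p zi
      + cb ρ q p * wb ρ p zi = Ci ρ p q zi := by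
  have h0' : (ρ 0 : ℂ) ≠ 0 := by exact_mod_cast h0
  simp only [db, mul_ite, mul_zero, Finset.sum_ite_eq', Finset.mem_range]
  rw [if_pos (by omega)]
  simp only [ca, cb, wb, zb, Ci]
  simp
  field_simp
  ring


lemma ev_left {ρ : ℕ → ℝ} {z : ℕ → ℂ} (h : pr M J ρ z ∈ dom M J) (l : ℕ) :
    ∀ᶠ t in nhds (ρ l), pr M J (Function.update ρ l t) z ∈ dom M J := by
  have hc : Continuous fun t : ℝ => pr M J (Function.update ρ l t) z := by
    simp only [pr_update_left]; fun_prop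
  apply hc.continuousAt.eventually_mem
  rw [Function.update_eq_self]
  exact dom_open.mem_nhds h

lemma ev_right {ρ : ℕ → ℝ} {z : ℕ → ℂ} (h : pr M J ρ z ∈ dom M J) (i : ℕ) :
    ∀ᶠ w in nhds (z i), pr M J ρ (Function.update z i w) ∈ dom M J := by
  have hc : Continuous fun w : ℂ => pr M J ρ (Function.update z i w) := by
    simp only [pr_update_right]; fun_prop
  apply hc.continuousAt.eventually_mem
  rw [Function.update_eq_self]
  exact dom_open.mem_nhds h

section Second

variable {F : (ℕ → ℝ) → (ℕ → ℂ) → ℂ} {ρ : ℕ → ℝ} {z : ℕ → ℂ} {p q : ℕ}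

lemma A_rho (hG : Good Ft) (hF : ∀ ρ z, F ρ z = Ft (pr M J ρ z))
    (h0 : ρ 0 ≠ 0) (hz : ∀ i ∈ J, z i ≠ 0) (hp : z p ≠ 0) (l : ℕ) :
    pdC (fun σ => AdagVar J p F σ z) l ρ =
      (∑ m ∈ Finset.range (M + 1),
        (da ρ (z p) l m * fderiv ℝ Ft (pr M J ρ z) (uu M J m)
          + ca ρ (z p) m * fderiv ℝ (fderiv ℝ Ft) (pr M J ρ z) (uu M J l) (uu M J m)))
      + ∑ i ∈ J, (db ρ (z p) (z i) l * fderiv ℝ Ft (pr M J ρ z) (vL M J i 1)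
          + cb ρ (z p) (z i)
            * fderiv ℝ (fderiv ℝ Ft) (pr M J ρ z) (uu M J l) (vL M J i 1)) := by
  have hx : pr M J ρ z ∈ dom M J := pr_mem h0 hz
  unfold pdC
  refine HasDerivAt.deriv ?_
  refine HasDerivAt.congr_of_eventuallyEq ?_
    ((ev_left hx l).mono fun t ht => first_apply hG hF ht p)
  refine HasDerivAt.fun_add (HasDerivAt.fun_sum fun m _ => ?_)
    (HasDerivAt.fun_sum fun i hi => ?_)
  · have := (ca_rho h0 hp l m).fun_mul (hG.d2_real hx (uu M J m) l)
    simpa only [Function.update_eq_self] using this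
  · have := (cb_rho h0 hp (hz i hi) l).fun_mul (hG.d2_real hx (vL M J i 1) l)
    simpa only [Function.update_eq_self] using this

lemma A_z (hG : Good Ft) (hF : ∀ ρ z, F ρ z = Ft (pr M J ρ z))
    (h0 : ρ 0 ≠ 0) (hz : ∀ i ∈ J, z i ≠ 0) (hp : z p ≠ 0) (hpJ : p ∉ J) {j : ℕ} (hj : j ∈ J) :
    deriv (fun v => AdagVar J p F ρ (Function.update z j v)) (z j) =
      (∑ m ∈ Finset.range (M + 1),
          ca ρ (z p) m * fderiv ℝ (fderiv ℝ Ft) (pr M J ρ z) (vL M J j 1) (uu M J m))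
      + ∑ i ∈ J, ((if i = j then zb ρ (z p) (z i) else 0)
            * fderiv ℝ Ft (pr M J ρ z) (vL M J i 1)
          + cb ρ (z p) (z i)
            * fderiv ℝ (fderiv ℝ Ft) (pr M J ρ z) (vL M J j 1) (vL M J i 1)) := by
  have hx : pr M J ρ z ∈ dom M J := pr_mem h0 hz
  have hpj : p ≠ j := fun e => hpJ (e ▸ hj)
  refine HasDerivAt.deriv ?_
  refine HasDerivAt.congr_of_eventuallyEq ?_
    ((ev_right hx j).mono fun t ht => first_apply hG hF ht p)
  simp only [Function.update_of_ne hpj]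
  refine HasDerivAt.fun_add (HasDerivAt.fun_sum fun m _ => ?_)
    (HasDerivAt.fun_sum fun i hi => ?_)
  · exact (hG.d2_cplx hx (uu M J m) j).const_mul _
  · by_cases hij : i = j
    · subst hij
      simp only [Function.update_self, if_true]
      have := (cb_z h0 hp (hz i hi)).fun_mul (hG.d2_cplx hx (vL M J i 1) i)
      simpa only [Function.update_eq_self] using this
    · simp only [Function.update_of_ne hij, if_neg hij, zero_mul, zero_add]
      exact (hG.d2_cplx hx (vL M J i 1) j).const_mul _

lemma A_w (hG : Good Ft) (hF : ∀ ρ z, F ρ z = Ft (pr M J ρ z))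
    (h0 : ρ 0 ≠ 0) (hz : ∀ i ∈ J, z i ≠ 0) (hp : z p ≠ 0) (hpJ : p ∉ J) :
    deriv (fun v => AdagVar J p F ρ (Function.update z p v)) (z p) =
      (∑ m ∈ Finset.range (M + 1), wa ρ (z p) m * fderiv ℝ Ft (pr M J ρ z) (uu M J m))
      + ∑ i ∈ J, wb ρ (z p) (z i) * fderiv ℝ Ft (pr M J ρ z) (vL M J i 1) := by
  have hx : pr M J ρ z ∈ dom M J := pr_mem h0 hz
  refine HasDerivAt.deriv ?_
  refine HasDerivAt.congr_of_eventuallyEq ?_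
    ((ev_right hx p).mono fun t ht => first_apply hG hF ht p)
  simp only [Function.update_self, pr_update_right, vL_zero hpJ, ContinuousLinearMap.zero_apply,
    add_zero]
  refine HasDerivAt.fun_add (HasDerivAt.fun_sum fun m _ => ?_)
    (HasDerivAt.fun_sum fun i hi => ?_)
  · exact (ca_w h0 hp m).mul_const _
  · have hip : i ≠ p := fun e => hpJ (e ▸ hi)
    simp only [Function.update_of_ne hip]
    exact (cb_w h0 hp (hz i hi)).mul_const _

lemma second_apply (hG : Good Ft) (hF : ∀ ρ z, F ρ z = Ft (pr M J ρ z))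
    (h0 : ρ 0 ≠ 0) (hz : ∀ i ∈ J, z i ≠ 0) (hp : z p ≠ 0) (hq : z q ≠ 0) (hpJ : p ∉ J) :
    AdagVar (insert p J) q (AdagVar J p F) ρ z =
      (∑ m ∈ Finset.range (M + 1),
          Cm ρ (z p) (z q) m * fderiv ℝ Ft (pr M J ρ z) (uu M J m))
      + (∑ i ∈ J, Ci ρ (z p) (z q) (z i) * fderiv ℝ Ft (pr M J ρ z) (vL M J i 1))
      + (∑ l ∈ Finset.range (M + 1), ∑ m ∈ Finset.range (M + 1),
          ca ρ (z q) l * ca ρ (z p) m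
            * fderiv ℝ (fderiv ℝ Ft) (pr M J ρ z) (uu M J l) (uu M J m))
      + (∑ l ∈ Finset.range (M + 1), ∑ i ∈ J,
          ca ρ (z q) l * cb ρ (z p) (z i)
            * fderiv ℝ (fderiv ℝ Ft) (pr M J ρ z) (uu M J l) (vL M J i 1))
      + (∑ j ∈ J, ∑ m ∈ Finset.range (M + 1),
          cb ρ (z q) (z j) * ca ρ (z p) m
            * fderiv ℝ (fderiv ℝ Ft) (pr M J ρ z) (vL M J j 1) (uu M J m))
      + (∑ j ∈ J, ∑ i ∈ J,
          cb ρ (z q) (z j) * cb ρ (z p) (z i)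
            * fderiv ℝ (fderiv ℝ Ft) (pr M J ρ z) (vL M J j 1) (vL M J i 1)) := by
  have e1 : AdagVar (insert p J) q (AdagVar J p F) ρ z
      = (∑ l ∈ Finset.range (M + 1 + 1),
          ca ρ (z q) l * pdC (fun σ => AdagVar J p F σ z) l ρ)
        + (cb ρ (z q) (z p) * deriv (fun v => AdagVar J p F ρ (Function.update z p v)) (z p)
        + ∑ j ∈ J, cb ρ (z q) (z j)
            * deriv (fun v => AdagVar J p F ρ (Function.update z j v)) (z j)) := by
    rw [AdagVar, AdagFree, Finset.sum_insert hpJ]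
    congr 1
    apply tsum_eq_sum
    intro l hl
    have hl' : M + 1 < l := by simpa using hl
    rw [A_rho hG hF h0 hz hp l, uu_zero (l := l) (by omega)]
    have hd : ∀ m ∈ Finset.range (M + 1), da ρ (z p) l m = 0 := by
      intro m hm
      have hm' : m < M + 1 := by simpa using hm
      simp only [da]
      rw [if_neg (by omega), if_neg (by omega), add_zero]
    have hd' : ∀ w, db ρ (z p) w l = 0 := by
      intro w
      simp only [db]
      rw [if_neg (by omega)]
    rw [Finset.sum_eq_zero, Finset.sum_eq_zero]
    · simp
    · intro i _
      simp [hd']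
    · intro m hm
      simp [hd m hm]
  rw [e1, A_w hG hF h0 hz hp hpJ]
  have e2 := Finset.sum_congr (s₁ := J) rfl
    fun j hj => congrArg (fun c => cb ρ (z q) (z j) * c) (A_z hG hF h0 hz hp hpJ hj)
  rw [e2]
  simp only [A_rho hG hF h0 hz hp]
  have hC1 : ∀ m ∈ Finset.range (M + 1),
      Cm ρ (z p) (z q) m * fderiv ℝ Ft (pr M J ρ z) (uu M J m) =
      (∑ l ∈ Finset.range (M + 1 + 1), ca ρ (z q) l
        * (da ρ (z p) l m * fderiv ℝ Ft (pr M J ρ z) (uu M J m)))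
      + cb ρ (z q) (z p) * (wa ρ (z p) m * fderiv ℝ Ft (pr M J ρ z) (uu M J m)) := by
    intro m hm
    rw [← Cm_eq h0 hp hq hm, add_mul, Finset.sum_mul]
    simp only [mul_assoc]
  have hC2 : ∀ i ∈ J,
      Ci ρ (z p) (z q) (z i) * fderiv ℝ Ft (pr M J ρ z) (vL M J i 1) =
      (∑ l ∈ Finset.range (M + 1 + 1), ca ρ (z q) l
        * (db ρ (z p) (z i) l * fderiv ℝ Ft (pr M J ρ z) (vL M J i 1)))
      + (∑ j ∈ J, cb ρ (z q) (z j) * ((if i = j then zb ρ (z p) (z i) else 0)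
            * fderiv ℝ Ft (pr M J ρ z) (vL M J i 1)))
      + cb ρ (z q) (z p) * (wb ρ (z p) (z i) * fderiv ℝ Ft (pr M J ρ z) (vL M J i 1)) := by
    intro i hi
    rw [← Ci_eq h0 hp hq (hz i hi) (M + 1), add_mul, add_mul, Finset.sum_mul]
    simp only [ite_mul, zero_mul, mul_ite, mul_zero, Finset.sum_ite_eq, if_pos hi]
    simp only [mul_assoc]
  rw [Finset.sum_congr rfl hC1, Finset.sum_congr rfl hC2]
  have hS : ∀ f : ℕ → ℂ, f (M + 1) = 0 →
      ∑ l ∈ Finset.range (M + 1), f l = ∑ l ∈ Finset.range (M + 1 + 1), f l := by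
    intro f hf
    rw [Finset.sum_range_succ f (M + 1), hf, add_zero]
  have hu : uu M J (M + 1) = 0 := uu_zero le_rfl
  rw [hS (fun l => ∑ m ∈ Finset.range (M + 1), _) (by simp [hu]),
    hS (fun l => ∑ i ∈ J, _) (by simp [hu])]
  simp only [mul_add, Finset.mul_sum, Finset.sum_add_distrib, mul_assoc]
  rw [Finset.sum_comm (s := Finset.range (M + 1)) (t := Finset.range (M + 1 + 1))
    (f := fun m l => ca ρ (z q) l * (da ρ (z p) l m * fderiv ℝ Ft (pr M J ρ z) (uu M J m)))]
  rw [Finset.sum_comm (s := J) (t := Finset.range (M + 1 + 1))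
    (f := fun i l => ca ρ (z q) l
        * (db ρ (z p) (z i) l * fderiv ℝ Ft (pr M J ρ z) (vL M J i 1)))]
  rw [Finset.sum_comm (s := J) (t := J)
    (f := fun i j => cb ρ (z q) (z j) * ((if i = j then zb ρ (z p) (z i) else 0)
            * fderiv ℝ Ft (pr M J ρ z) (vL M J i 1)))]
  ring

end Second

end Helpers

end NCQFT

open NCQFT in
/-- Boundary creation operators commute: for distinct `p, q ∉ J` and every
smooth `F` of `(ϱ₀ ≠ 0, ϱ₁, …, ϱ_M; (z_i)_{i∈J})`,
`Â†_{z_{J∪{p}},z_q}(Â†_{z_J,z_p}F) = Â†_{z_{J∪{q}},z_p}(Â†_{z_J,z_q}F)` wherever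
`z_p ≠ 0` and `z_q ≠ 0`. -/
theorem stmt2 (J : Finset ℕ) (p q : ℕ) (hp : p ∉ J) (hq : q ∉ J) (hpq : p ≠ q)
    (M : ℕ) (F : (ℕ → ℝ) → (ℕ → ℂ) → ℂ) (hF : SmoothFam M J F)
    (ρ : ℕ → ℝ) (hρ0 : ρ 0 ≠ 0) (z : ℕ → ℂ)
    (hzJ : ∀ i ∈ J, z i ≠ 0) (hzp : z p ≠ 0) (hzq : z q ≠ 0) :
    AdagVar (insert p J) q (AdagVar J p F) ρ z
      = AdagVar (insert q J) p (AdagVar J q F) ρ z := by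
  obtain ⟨Ft, h1, h2, h3⟩ := hF
  have hG : Good (M := M) (J := J) Ft := ⟨h1, h2⟩
  have hx : pr M J ρ z ∈ dom M J := pr_mem hρ0 hzJ
  rw [second_apply hG h3 hρ0 hzJ hzp hzq hp, second_apply hG h3 hρ0 hzJ hzq hzp hq]
  simp only [Cm_comm ρ (z p) (z q), Ci_comm ρ (z p) (z q)]
  rw [Finset.sum_comm (s := Finset.range (M + 1)) (t := Finset.range (M + 1))]
  rw [Finset.sum_comm (s := Finset.range (M + 1)) (t := J)
    (f := fun l i => ca ρ (z q) l * cb ρ (z p) (z i)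
            * fderiv ℝ (fderiv ℝ Ft) (pr M J ρ z) (uu M J l) (vL M J i 1))]
  rw [Finset.sum_comm (s := Finset.range (M + 1)) (t := J)
    (f := fun l i => ca ρ (z p) l * cb ρ (z q) (z i)
            * fderiv ℝ (fderiv ℝ Ft) (pr M J ρ z) (uu M J l) (vL M J i 1))]
  rw [Finset.sum_comm (s := J) (t := J)]
  have s1 : ∀ l m, ca ρ (z q) m * ca ρ (z p) l
        * fderiv ℝ (fderiv ℝ Ft) (pr M J ρ z) (uu M J m) (uu M J l)
      = ca ρ (z p) l * ca ρ (z q) m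
        * fderiv ℝ (fderiv ℝ Ft) (pr M J ρ z) (uu M J l) (uu M J m) := by
    intro l m; rw [hG.symm hx]; ring
  have s2 : ∀ a b : ℕ, ∀ l i, ca ρ (z a) l * cb ρ (z b) (z i)
        * fderiv ℝ (fderiv ℝ Ft) (pr M J ρ z) (uu M J l) (vL M J i 1)
      = cb ρ (z b) (z i) * ca ρ (z a) l
        * fderiv ℝ (fderiv ℝ Ft) (pr M J ρ z) (vL M J i 1) (uu M J l) := by
    intro a b l i; rw [hG.symm hx]; ring
  have s3 : ∀ i j, cb ρ (z q) (z j) * cb ρ (z p) (z i)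
        * fderiv ℝ (fderiv ℝ Ft) (pr M J ρ z) (vL M J j 1) (vL M J i 1)
      = cb ρ (z p) (z i) * cb ρ (z q) (z j)
        * fderiv ℝ (fderiv ℝ Ft) (pr M J ρ z) (vL M J i 1) (vL M J j 1) := by
    intro i j; rw [hG.symm hx]; ring
  simp only [s2]
  rw [Finset.sum_congr rfl fun l _ => Finset.sum_congr rfl fun m _ => s1 l m]
  rw [Finset.sum_congr rfl fun i _ => Finset.sum_congr rfl fun j _ => s3 i j]
  ring
end
end

section
/- Assume ϱ₀ ≠ 0 and let λ ∈ ℝ. The function G₁(z) := 2λ⁴ϱ₁/(ϱ₀²z³) − 2λ⁴/(ϱ₀z⁵) satisfies K̂(G₁)(z) = −2λ⁴/z⁴ for every admissible z; i.e. G₁ solves the genus-one Dyson–Schwinger equation K̂G₁ = −2λ²·G₀(z|z) with G₀(z|z) := λ²/z⁴. -/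
open scoped BigOperators
open MeasureTheory

noncomputable section

theorem stmt3_aux (a b s nbar : ℝ) (r : ℝ → ℝ)
    (ha : 0 < a) (hab : a < b)
    (hr : ContinuousOn r (Set.Icc a b))
    (z c d : ℂ) (hz : NCQFT.Admissible a b z) (f : ℂ → ℂ)
    (hf : ∀ w, f w = c / w ^ 3 - d / w ^ 5) :
    NCQFT.Khat a b s nbar r f z
      = c * (NCQFT.moment a b s r 0 : ℂ) / z ^ 2
        - d * ((NCQFT.moment a b s r 0 : ℂ) / z ^ 4 + (NCQFT.moment a b s r 1 : ℂ) / z ^ 2) := by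
  obtain ⟨hz0, hz1⟩ := hz
  have hu : Set.uIcc a b = Set.Icc a b := Set.uIcc_of_le hab.le
  have hrc : ContinuousOn (fun y : ℝ => (r y : ℂ)) (Set.uIcc a b) := by
    rw [hu]; exact Complex.continuous_ofReal.comp_continuousOn hr
  have hy0 : ∀ y ∈ Set.uIcc a b, (y : ℂ) ≠ 0 := by
    intro y hy
    rw [hu] at hy
    exact_mod_cast (lt_of_lt_of_le ha hy.1).ne'
  have hplus : ∀ y ∈ Set.uIcc a b, z + (y : ℂ) ≠ 0 := by
    intro y hy h
    rw [hu] at hy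
    exact (hz1 y hy).2 (eq_neg_of_add_eq_zero_left h)
  have hminus : ∀ y ∈ Set.uIcc a b, z - (y : ℂ) ≠ 0 := by
    intro y hy h
    rw [hu] at hy
    exact (hz1 y hy).1 (sub_eq_zero.mp h)
  have i0 : IntervalIntegrable (fun y : ℝ => (r y : ℂ) / ((z + (y : ℂ)) * (y : ℂ))) volume a b := by
    apply ContinuousOn.intervalIntegrable
    apply hrc.div
    · exact Continuous.continuousOn (by fun_prop)
    · intro y hy
      exact mul_ne_zero (hplus y hy) (hy0 y hy)
  have ip : ∀ n : ℕ, IntervalIntegrable (fun y : ℝ => (r y : ℂ) / (y : ℂ) ^ n) volume a b := by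
    intro n
    apply ContinuousOn.intervalIntegrable
    apply hrc.div
    · exact Continuous.continuousOn (by fun_prop)
    · intro y hy
      exact pow_ne_zero _ (hy0 y hy)
  have hm : ∀ n : ℕ, ((∫ y in a..b, r y / y ^ n : ℝ) : ℂ)
      = ∫ y in a..b, (r y : ℂ) / (y : ℂ) ^ n := by
    intro n
    rw [← intervalIntegral.integral_ofReal]
    congr 1
    funext y
    push_cast
    rfl
  have key : (∫ y in a..b, (r y : ℂ) * (f z - f (y : ℂ)) / (z ^ 2 - (y : ℂ) ^ 2))
      = -(c / z ^ 3 - d / z ^ 5) * (∫ y in a..b, (r y : ℂ) / ((z + (y : ℂ)) * (y : ℂ)))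
        + (-c / z ^ 2 + d / z ^ 4) * (∫ y in a..b, (r y : ℂ) / (y : ℂ) ^ 3)
        + d / z ^ 2 * (∫ y in a..b, (r y : ℂ) / (y : ℂ) ^ 5) := by
    rw [← intervalIntegral.integral_const_mul, ← intervalIntegral.integral_const_mul,
      ← intervalIntegral.integral_const_mul,
      ← intervalIntegral.integral_add (i0.const_mul _) ((ip 3).const_mul _),
      ← intervalIntegral.integral_add ((i0.const_mul _).add ((ip 3).const_mul _))
        ((ip 5).const_mul _)]
    apply intervalIntegral.integral_congr
    intro y hy
    have h1 := hy0 y hy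
    have h2 := hplus y hy
    have h3 := hminus y hy
    have h4 : z ^ 2 - (y : ℂ) ^ 2 = (z - y) * (z + y) := by ring
    simp only [hf, h4]
    field_simp
    ring
  unfold NCQFT.Khat NCQFT.G0fun NCQFT.moment
  rw [key, hf]
  push_cast
  simp only [Nat.mul_zero, Nat.mul_one, Nat.add_zero, hm]
  norm_num
  field_simp
  ring

open NCQFT in
/-- `G₁(z) = 2λ⁴ϱ₁/(ϱ₀²z³) − 2λ⁴/(ϱ₀z⁵)` satisfies the genus-one
Dyson–Schwinger equation `K̂G₁(z) = −2λ⁴/z⁴` at every admissible `z`. -/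
theorem stmt3 (a b s nbar : ℝ) (r : ℝ → ℝ)
    (ha : 0 < a) (hab : a < b)
    (hr : ContinuousOn r (Set.Icc a b)) (hrpos : ∀ y ∈ Set.Icc a b, 0 ≤ r y)
    (hs : 0 < s) (hρ0 : moment a b s r 0 ≠ 0) (lam : ℝ)
    (z : ℂ) (hz : Admissible a b z) :
    Khat a b s nbar r
      (fun w => 2 * (lam : ℂ) ^ 4 * (moment a b s r 1 : ℂ) /
          ((moment a b s r 0 : ℂ) ^ 2 * w ^ 3)
        - 2 * (lam : ℂ) ^ 4 / ((moment a b s r 0 : ℂ) * w ^ 5)) z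
      = -(2 * (lam : ℂ) ^ 4) / z ^ 4 := by
  have h0 : (moment a b s r 0 : ℂ) ≠ 0 := by exact_mod_cast hρ0
  rw [stmt3_aux a b s nbar r ha hab hr z
    (2 * (lam : ℂ) ^ 4 * (moment a b s r 1 : ℂ) / (moment a b s r 0 : ℂ) ^ 2)
    (2 * (lam : ℂ) ^ 4 / (moment a b s r 0 : ℂ)) hz _
    (fun w => by rw [div_div, div_div])]
  have hz0 := hz.1
  field_simp
  ring
end
end

section
/- Assume ϱ₀ ≠ 0. For every even Laurent polynomial f(z) = Σ_{k=0}^{K} a_{2k}/z^{2k} with real coefficients, define (If)(z) := (1/ϱ₀)·Σ_{k=0}^{K} a_{2k}·Σ_{j=0}^{k} S_j(ϱ)/(j!·z^{2k−2j+2}). Then z²·K̂(y ↦ (If)(y)/y)(z) = f(z) for every admissible z; i.e. If inverts the operator f ↦ z²·K̂(f/z) on even Laurent polynomials bounded at ∞ (If equals −Res_{w→0}[K(z,w)f(w)dw] for the kernel K(z,w) := 2/((G₀(w)−G₀(−w))(w²−z²)) expanded about w = 0). -/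
open scoped BigOperators
open MeasureTheory

noncomputable section

namespace NCQFT

lemma multinom_term (m i : ℕ) (hi : i ≤ m) (ρ : ℕ → ℝ) :
    PowerSeries.coeff m ((∑ q : Fin m, PowerSeries.monomial ((q : ℕ) + 1) (ρ ((q : ℕ) + 1))) ^ i)
      = (i.factorial : ℝ) * bellP m i (fun j => (j.factorial : ℝ) * ρ j) / (m.factorial : ℝ) := by
  classical
  have hm : (m.factorial : ℝ) ≠ 0 := by positivity
  rw [Finset.sum_pow_eq_sum_piAntidiag, map_sum, bellP, Finset.mul_sum, Finset.sum_div]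
  have key : ∀ k : Fin m → ℕ, k ∈ Finset.piAntidiag Finset.univ i →
      PowerSeries.coeff m ((Nat.multinomial Finset.univ k : PowerSeries ℝ) *
        ∏ q : Fin m, (PowerSeries.monomial ((q : ℕ) + 1) (ρ ((q : ℕ) + 1))) ^ k q)
      = if (∑ q : Fin m, ((q : ℕ) + 1) * k q) = m then
          (i.factorial : ℝ) / (∏ q : Fin m, ((k q).factorial : ℝ)) *
            ∏ q : Fin m, (ρ ((q : ℕ) + 1)) ^ k q else 0 := by
    intro k hk
    rw [Finset.mem_piAntidiag] at hk
    have h1 : (∏ q : Fin m, (PowerSeries.monomial ((q : ℕ) + 1) (ρ ((q : ℕ) + 1))) ^ k q)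
        = PowerSeries.monomial (∑ q : Fin m, ((q : ℕ) + 1) * k q)
            (∏ q : Fin m, (ρ ((q : ℕ) + 1)) ^ k q) := by
      simp [PowerSeries.monomial_eq_C_mul_X_pow, Finset.prod_mul_distrib, mul_pow, ← pow_mul,
        Finset.prod_pow_eq_pow_sum, mul_comm]
    have h2 : ((Nat.multinomial Finset.univ k : ℕ) : ℝ)
        = (i.factorial : ℝ) / (∏ q : Fin m, ((k q).factorial : ℝ)) := by
      have := Nat.multinomial_spec (Finset.univ) k
      rw [hk.1] at this
      rw [eq_div_iff (by positivity), mul_comm]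
      exact_mod_cast this
    rw [h1, ← h2, ← map_natCast (PowerSeries.C (R := ℝ)), PowerSeries.coeff_C_mul,
      PowerSeries.coeff_monomial]
    by_cases h : m = ∑ q : Fin m, ((q : ℕ) + 1) * k q
    · rw [if_pos h, if_pos h.symm]
    · rw [if_neg h, if_neg (Ne.symm h), mul_zero]
  rw [Finset.sum_congr rfl key]
  symm
  have key2 : ∀ j : Fin m → Fin (m + 1),
      (i.factorial : ℝ) * (if (∑ q : Fin m, (j q : ℕ)) = i ∧
          (∑ q : Fin m, ((q : ℕ) + 1) * (j q : ℕ)) = m then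
        (m.factorial : ℝ) / (∏ q : Fin m, ((j q : ℕ).factorial : ℝ)) *
        ∏ q : Fin m, ((((q : ℕ) + 1).factorial : ℝ) * ρ ((q : ℕ) + 1) /
          (((q : ℕ) + 1).factorial : ℝ)) ^ (j q : ℕ)
        else 0) / (m.factorial : ℝ)
      = if (∑ q : Fin m, (j q : ℕ)) = i then
        (if (∑ q : Fin m, ((q : ℕ) + 1) * (j q : ℕ)) = m then
          (i.factorial : ℝ) / (∏ q : Fin m, ((j q : ℕ).factorial : ℝ)) *
            ∏ q : Fin m, (ρ ((q : ℕ) + 1)) ^ (j q : ℕ) else 0) else 0 := by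
    intro j
    have : ∀ q : Fin m, (((q : ℕ) + 1).factorial : ℝ) * ρ ((q : ℕ) + 1) /
          (((q : ℕ) + 1).factorial : ℝ) = ρ ((q : ℕ) + 1) := fun q => by
      have : (((q : ℕ) + 1).factorial : ℝ) ≠ 0 := by positivity
      field_simp
    simp only [this]
    by_cases h1 : (∑ q : Fin m, (j q : ℕ)) = i
    · by_cases h2 : (∑ q : Fin m, ((q : ℕ) + 1) * (j q : ℕ)) = m
      · rw [if_pos ⟨h1, h2⟩, if_pos h1, if_pos h2]
        field_simp
      · rw [if_neg (fun h => h2 h.2), if_pos h1, if_neg h2]; simp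
    · rw [if_neg (fun h => h1 h.1), if_neg h1]; simp
  rw [Finset.sum_congr rfl (fun j _ => key2 j), ← Finset.sum_filter]
  refine Finset.sum_bij (fun j _ => fun q => (j q : ℕ)) ?_ ?_ ?_ ?_
  · intro j hj
    simp only [Finset.mem_filter, Finset.mem_univ, true_and] at hj
    simp [Finset.mem_piAntidiag, hj]
  · intro j _ j' _ h
    funext q
    exact Fin.ext (congrFun h q)
  · intro k hk
    simp only [Finset.mem_piAntidiag] at hk
    have hle : ∀ q, k q < m + 1 := fun q => by
      have := Finset.single_le_sum (f := k) (fun _ _ => Nat.zero_le _) (Finset.mem_univ q)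
      have h' : ∑ x, k x = i := hk.1
      exact Nat.lt_succ_of_le ((this.trans_eq h').trans hi)
    refine ⟨fun q => ⟨k q, hle q⟩, ?_, rfl⟩
    simp [hk.1]
  · intro j _
    rfl

/-- The generating series of the moments without constant term. -/
def PS (ρ : ℕ → ℝ) : PowerSeries ℝ := PowerSeries.mk (fun n => if n = 0 then 0 else ρ n)

lemma PS_coeff_pow (m i : ℕ) (hi : i ≤ m) (ρ : ℕ → ℝ) :
    PowerSeries.coeff m (PS ρ ^ i)
      = (i.factorial : ℝ) * bellP m i (fun j => (j.factorial : ℝ) * ρ j) / (m.factorial : ℝ) := by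
  rw [← multinom_term m i hi, ← sub_eq_zero, ← map_sub]
  have h1 : (PowerSeries.X : PowerSeries ℝ) ^ (m + 1) ∣
      PS ρ - ∑ q : Fin m, PowerSeries.monomial ((q : ℕ) + 1) (ρ ((q : ℕ) + 1)) := by
    rw [PowerSeries.X_pow_dvd_iff]
    intro n hn
    rw [map_sub, map_sum, PS, PowerSeries.coeff_mk, sub_eq_zero]
    simp only [PowerSeries.coeff_monomial]
    rcases n with _ | n
    · simp
    · rw [Finset.sum_eq_single (⟨n, by omega⟩ : Fin m)]
      · simp
      · intro q _ hq
        rw [if_neg]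
        intro h
        exact hq (Fin.ext (by simp at h ⊢; omega))
      · simp
  exact PowerSeries.X_pow_dvd_iff.1 (h1.trans (sub_dvd_pow_sub_pow _ _ i)) m (Nat.lt_succ_self m)

lemma X_dvd_PS (ρ : ℕ → ℝ) : PowerSeries.X ∣ PS ρ := by
  rw [PowerSeries.X_dvd_iff, ← PowerSeries.coeff_zero_eq_constantCoeff_apply]
  simp [PS]

lemma Sm_coeff (ρ : ℕ → ℝ) (m M : ℕ) (h : m ≤ M) :
    Sm ρ m / (m.factorial : ℝ) = PowerSeries.coeff m
      (∑ i ∈ Finset.range (M + 1), (-(PowerSeries.C (ρ 0)⁻¹ * PS ρ)) ^ i) := by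
  have e : ∀ i, PowerSeries.coeff m ((-(PowerSeries.C (ρ 0)⁻¹ * PS ρ)) ^ i)
      = (-1) ^ i * ((ρ 0)⁻¹) ^ i * PowerSeries.coeff m (PS ρ ^ i) := fun i => by
    have : (-(PowerSeries.C (ρ 0)⁻¹ * PS ρ)) ^ i
        = PowerSeries.C ((-1) ^ i * ((ρ 0)⁻¹) ^ i) * PS ρ ^ i := by
      rw [neg_pow, mul_pow, map_mul, map_pow, map_pow, map_neg, map_one, mul_assoc]
    rw [this, PowerSeries.coeff_C_mul]
  rw [map_sum, Sm, Finset.sum_div]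
  simp only [e]
  rw [← Finset.sum_subset (Finset.range_mono (Nat.succ_le_succ h))]
  · refine Finset.sum_congr rfl fun i hi => ?_
    rw [PS_coeff_pow m i (by simpa [Nat.lt_succ_iff] using hi)]
    ring
  · intro i _ hi
    rw [PowerSeries.X_pow_dvd_iff.1 (pow_dvd_pow_of_dvd (X_dvd_PS ρ) i) m
      (by simpa using hi), mul_zero]

lemma Sm_mul (ρ : ℕ → ℝ) (h0 : ρ 0 ≠ 0) :
    PowerSeries.mk (fun m => Sm ρ m / (m.factorial : ℝ)) * PowerSeries.mk ρ
      = PowerSeries.C (ρ 0) := by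
  ext M
  set Q := (-(PowerSeries.C (ρ 0)⁻¹ * PS ρ)) with hQ
  have hR : PowerSeries.mk ρ = PowerSeries.C (ρ 0) * (1 - Q) := by
    have : PowerSeries.C (ρ 0) * (1 - Q) = PowerSeries.C (ρ 0) +
        PowerSeries.C (ρ 0 * (ρ 0)⁻¹) * PS ρ := by
      rw [hQ, map_mul]; ring
    rw [this, mul_inv_cancel₀ h0]
    ext n
    rcases n with _ | n <;> simp [PS]
  have h1 : PowerSeries.coeff M (PowerSeries.mk (fun m => Sm ρ m / (m.factorial : ℝ)) *
      PowerSeries.mk ρ) = PowerSeries.coeff M ((∑ i ∈ Finset.range (M + 1), Q ^ i) *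
      PowerSeries.mk ρ) := by
    rw [PowerSeries.coeff_mul, PowerSeries.coeff_mul]
    refine Finset.sum_congr rfl fun p hp => ?_
    rw [PowerSeries.coeff_mk, Sm_coeff ρ p.1 M (by
      have := Finset.HasAntidiagonal.mem_antidiagonal.1 hp; omega)]
  have h2 : (∑ i ∈ Finset.range (M + 1), Q ^ i) * PowerSeries.mk ρ
      = PowerSeries.C (ρ 0) - PowerSeries.C (ρ 0) * Q ^ (M + 1) := by
    have := geom_sum_mul_neg Q (M + 1)
    rw [hR]
    linear_combination (PowerSeries.C (ρ 0)) * this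
  have h3 : PowerSeries.coeff M (Q ^ (M + 1)) = 0 := by
    refine PowerSeries.X_pow_dvd_iff.1 (pow_dvd_pow_of_dvd ?_ (M + 1)) M (Nat.lt_succ_self M)
    exact (dvd_neg.2 ((X_dvd_PS ρ).mul_left _))
  rw [h1, h2, map_sub, PowerSeries.coeff_C_mul, h3, mul_zero, sub_zero]

lemma Sm_conv (ρ : ℕ → ℝ) (h0 : ρ 0 ≠ 0) (w : ℂ) (k : ℕ) :
    ∑ j ∈ Finset.range (k + 1), (Sm ρ j : ℂ) / (j.factorial : ℂ) *
      ∑ l ∈ Finset.range (k - j + 1), (ρ l : ℂ) * w ^ (k - j - l) = (ρ 0 : ℂ) * w ^ k := by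
  have h := congrArg (PowerSeries.map Complex.ofRealHom) (Sm_mul ρ h0)
  have h2 := congrArg (fun P => PowerSeries.coeff k (P * PowerSeries.mk (fun n => w ^ n))) h
  simp only [map_mul, mul_assoc, PowerSeries.map_C, PowerSeries.coeff_C_mul,
    PowerSeries.coeff_mk] at h2
  rw [PowerSeries.coeff_mul, Finset.Nat.sum_antidiagonal_eq_sum_range_succ_mk] at h2
  simp only [PowerSeries.coeff_mul, Finset.Nat.sum_antidiagonal_eq_sum_range_succ_mk,
    PowerSeries.coeff_map, PowerSeries.coeff_mk] at h2
  simpa using h2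

end NCQFT

namespace NCQFT

lemma adm_ne {a b : ℝ} {z : ℂ} (ha : 0 < a) (hz : Admissible a b z) {y : ℝ}
    (hy : y ∈ Set.Icc a b) : (y : ℂ) ≠ 0 ∧ z + (y : ℂ) ≠ 0 ∧ z - (y : ℂ) ≠ 0
      ∧ z ^ 2 - (y : ℂ) ^ 2 ≠ 0 := by
  obtain ⟨h1, h2⟩ := hz.2 y hy
  have h3 : z + (y : ℂ) ≠ 0 := fun h => h2 (eq_neg_of_add_eq_zero_left h)
  have h4 : z - (y : ℂ) ≠ 0 := sub_ne_zero.2 h1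
  refine ⟨?_, h3, h4, ?_⟩
  · exact_mod_cast (lt_of_lt_of_le ha hy.1).ne'
  · rw [sq_sub_sq]; exact mul_ne_zero h3 h4

lemma cont_r {a b : ℝ} {r : ℝ → ℝ} (hr : ContinuousOn r (Set.Icc a b)) :
    ContinuousOn (fun y : ℝ => (r y : ℂ)) (Set.Icc a b) :=
  Complex.continuous_ofReal.comp_continuousOn hr

lemma integ2 {a b : ℝ} {r : ℝ → ℝ} (ha : 0 < a) (hab : a < b)
    (hr : ContinuousOn r (Set.Icc a b)) {z : ℂ} (hz : Admissible a b z) (f : ℂ → ℂ)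
    (hf : ContinuousOn (fun y : ℝ => f y) (Set.Icc a b)) :
    IntervalIntegrable (fun y : ℝ => (r y : ℂ) * (f z - f (y : ℂ)) / (z ^ 2 - (y : ℂ) ^ 2))
      volume a b := by
  apply ContinuousOn.intervalIntegrable
  rw [Set.uIcc_of_le hab.le]
  refine ContinuousOn.div ((cont_r hr).mul (continuousOn_const.sub hf)) (by fun_prop) ?_
  intro y hy
  exact (adm_ne ha hz hy).2.2.2

lemma Khat_sum {a b s nbar : ℝ} {r : ℝ → ℝ} (ha : 0 < a) (hab : a < b)
    (hr : ContinuousOn r (Set.Icc a b)) {z : ℂ} (hz : Admissible a b z)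
    (S : Finset ℕ) (c : ℕ → ℂ) (f : ℕ → ℂ → ℂ)
    (hf : ∀ k ∈ S, ContinuousOn (fun y : ℝ => f k y) (Set.Icc a b)) :
    Khat a b s nbar r (fun y => ∑ k ∈ S, c k * f k y) z
      = ∑ k ∈ S, c k * Khat a b s nbar r (f k) z := by
  have : ∀ y : ℝ, (r y : ℂ) * ((∑ k ∈ S, c k * f k z) - ∑ k ∈ S, c k * f k y) /
      (z ^ 2 - (y : ℂ) ^ 2) = ∑ k ∈ S, c k * ((r y : ℂ) * (f k z - f k (y : ℂ)) /
      (z ^ 2 - (y : ℂ) ^ 2)) := fun y => by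
    rw [← Finset.sum_sub_distrib, Finset.mul_sum, Finset.sum_div]
    exact Finset.sum_congr rfl fun k _ => by ring
  unfold Khat
  simp only [this]
  rw [intervalIntegral.integral_finsetSum
    (fun k hk => (integ2 ha hab hr hz (f k) (hf k hk)).const_mul _)]
  simp only [intervalIntegral.integral_const_mul, Finset.mul_sum]
  rw [← Finset.sum_add_distrib, ← Finset.sum_add_distrib]
  exact Finset.sum_congr rfl fun k _ => by ring

lemma cont_mono {a b : ℝ} (ha : 0 < a) (n : ℕ) :
    ContinuousOn (fun y : ℝ => (1 : ℂ) / (y : ℂ) ^ n) (Set.Icc a b) := by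
  refine ContinuousOn.div continuousOn_const (by fun_prop) ?_
  intro y hy
  refine pow_ne_zero _ ?_
  exact_mod_cast (lt_of_lt_of_le ha hy.1).ne'

lemma mono_alg (z y : ℂ) (hz : z ≠ 0) (hy : y ≠ 0) (h1 : z + y ≠ 0)
    (h3 : z ^ 2 - y ^ 2 ≠ 0) (n : ℕ) :
    1 / ((z + y) * y) * (1 / z ^ (2 * n + 3))
      + (1 / z ^ (2 * n + 3) - 1 / y ^ (2 * n + 3)) / (z ^ 2 - y ^ 2)
      = -∑ l ∈ Finset.range (n + 1), (1 / z ^ 2) * ((1 / z ^ 2) ^ (n - l) * (1 / y ^ (3 + 2 * l))) := by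
  have hg := (Commute.all (1 / y ^ 2) (1 / z ^ 2)).geom_sum₂_mul (n + 1)
  have e : ∑ l ∈ Finset.range (n + 1), (1 / z ^ 2) * ((1 / z ^ 2) ^ (n - l) * (1 / y ^ (3 + 2 * l)))
      = (1 / z ^ 2) * (1 / y ^ 3) *
        ∑ l ∈ Finset.range (n + 1), (1 / y ^ 2) ^ l * (1 / z ^ 2) ^ (n + 1 - 1 - l) := by
    rw [Finset.mul_sum]
    refine Finset.sum_congr rfl fun l _ => ?_
    rw [Nat.add_sub_cancel, pow_add, div_pow 1 (y ^ 2), ← pow_mul, one_pow]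
    field_simp
  rw [e]
  generalize (∑ l ∈ Finset.range (n + 1), (1 / y ^ 2) ^ l * (1 / z ^ 2) ^ (n + 1 - 1 - l)) = T at hg
  have hd : (1 / y ^ 2 - 1 / z ^ 2 : ℂ) = (z ^ 2 - y ^ 2) / (y ^ 2 * z ^ 2) := by
    field_simp
  have hT : T = ((1 / y ^ 2) ^ (n + 1) - (1 / z ^ 2) ^ (n + 1)) * (y ^ 2 * z ^ 2)
      / (z ^ 2 - y ^ 2) := by
    rw [← hg, hd]; field_simp
  have hm : 1 / ((z + y) * y) = (z - y) / ((z ^ 2 - y ^ 2) * y) := by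
    field_simp; ring
  rw [hT, hm, show 2 * n + 3 = 2 * (n + 1) + 1 by ring, pow_succ z (2 * (n + 1)),
    pow_succ y (2 * (n + 1)), pow_mul, pow_mul, div_pow, div_pow, one_pow]
  have hp : (z ^ 2) ^ (n + 1) ≠ 0 := by positivity
  have hq : (y ^ 2) ^ (n + 1) ≠ 0 := by positivity
  generalize (z ^ 2) ^ (n + 1) = p at *
  generalize (y ^ 2) ^ (n + 1) = q at *
  field_simp
  ring

lemma Khat_mono {a b s nbar : ℝ} {r : ℝ → ℝ} (ha : 0 < a) (hab : a < b)
    (hr : ContinuousOn r (Set.Icc a b)) {z : ℂ} (hz : Admissible a b z) (n : ℕ) :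
    z ^ 2 * Khat a b s nbar r (fun y => 1 / y ^ (2 * n + 3)) z
      = ∑ l ∈ Finset.range (n + 1), (moment a b s r l : ℂ) * (1 / z ^ 2) ^ (n - l) := by
  have hz0 := hz.1
  have i1 : IntervalIntegrable (fun y : ℝ => (r y : ℂ) / ((z + (y : ℂ)) * (y : ℂ)) *
      (1 / z ^ (2 * n + 3))) volume a b := by
    apply ContinuousOn.intervalIntegrable
    rw [Set.uIcc_of_le hab.le]
    refine ContinuousOn.mul (ContinuousOn.div (cont_r hr) (by fun_prop) ?_) continuousOn_const
    intro y hy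
    exact mul_ne_zero (adm_ne ha hz hy).2.1 (adm_ne ha hz hy).1
  have i2 := integ2 ha hab hr hz (fun y => 1 / y ^ (2 * n + 3)) (cont_mono ha _)
  have i3 : ∀ l : ℕ, IntervalIntegrable (fun y : ℝ => (r y : ℂ) / (y : ℂ) ^ (3 + 2 * l))
      volume a b := fun l => by
    apply ContinuousOn.intervalIntegrable
    rw [Set.uIcc_of_le hab.le]
    refine ContinuousOn.div (cont_r hr) (by fun_prop) ?_
    intro y hy
    exact pow_ne_zero _ (adm_ne ha hz hy).1
  have hm : ∀ l, (moment a b s r l : ℂ) = (if l = 0 then (s : ℂ) else 0)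
      - (1 / 2) * ∫ y in a..b, (r y : ℂ) / (y : ℂ) ^ (3 + 2 * l) := fun l => by
    have : ∫ y in a..b, (r y : ℂ) / (y : ℂ) ^ (3 + 2 * l)
        = ((∫ y in a..b, r y / y ^ (3 + 2 * l) : ℝ) : ℂ) := by
      rw [← intervalIntegral.integral_ofReal]
      simp
    rw [this, moment]
    split_ifs <;> simp
  have hI : (∫ y in a..b, (r y : ℂ) / ((z + (y : ℂ)) * (y : ℂ))) * (1 / z ^ (2 * n + 3))
      + ∫ y in a..b, (r y : ℂ) * (1 / z ^ (2 * n + 3) - 1 / (y : ℂ) ^ (2 * n + 3))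
          / (z ^ 2 - (y : ℂ) ^ 2)
      = -∑ l ∈ Finset.range (n + 1), (1 / z ^ 2) * ((1 / z ^ 2) ^ (n - l) *
          ∫ y in a..b, (r y : ℂ) / (y : ℂ) ^ (3 + 2 * l)) := by
    rw [← intervalIntegral.integral_mul_const, ← intervalIntegral.integral_add i1 i2]
    simp only [← intervalIntegral.integral_const_mul]
    rw [← intervalIntegral.integral_finsetSum
      (fun l _ => ((i3 l).const_mul _).const_mul _), ← intervalIntegral.integral_neg]
    refine intervalIntegral.integral_congr fun y hy => ?_
    rw [Set.uIcc_of_le hab.le] at hy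
    obtain ⟨h0, h1, _, h3⟩ := adm_ne ha hz hy
    have := congrArg (fun t => (r y : ℂ) * t) (mono_alg z y hz0 h0 h1 h3 n)
    simp only [mul_neg, Finset.mul_sum] at this
    refine Eq.trans ?_ (this.trans ?_)
    · ring
    · congr 1
      exact Finset.sum_congr rfl fun l _ => by ring
  have hL : Khat a b s nbar r (fun y => 1 / y ^ (2 * n + 3)) z
      = (s : ℂ) * z * (1 / z ^ (2 * n + 3)) + (1 / 2) * (-∑ l ∈ Finset.range (n + 1),
        (1 / z ^ 2) * ((1 / z ^ 2) ^ (n - l) *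
          ∫ y in a..b, (r y : ℂ) / (y : ℂ) ^ (3 + 2 * l))) := by
    rw [← hI]
    unfold Khat G0fun
    ring
  rw [hL]
  simp only [hm, sub_mul, Finset.sum_sub_distrib]
  have e0 : ∑ x ∈ Finset.range (n + 1), (if x = 0 then (s : ℂ) else 0) * (1 / z ^ 2) ^ (n - x)
      = s * (1 / z ^ 2) ^ n := by
    rw [Finset.sum_eq_single 0 (fun l _ hl => by simp [hl]) (by simp)]
    simp
  rw [e0]
  rw [← Finset.mul_sum, mul_add]
  have e1 : z ^ 2 * ((s : ℂ) * z * (1 / z ^ (2 * n + 3))) = s * (1 / z ^ 2) ^ n := by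
    rw [div_pow, one_pow, ← pow_mul, pow_add]; field_simp
  rw [e1]
  have e2 : ∑ l ∈ Finset.range (n + 1), (1 / 2 : ℂ) * (∫ y in a..b, (r y : ℂ) / (y : ℂ) ^ (3 + 2 * l))
      * (1 / z ^ 2) ^ (n - l) = (1 / 2) * ∑ l ∈ Finset.range (n + 1), ((1 / z ^ 2) ^ (n - l) *
          ∫ y in a..b, (r y : ℂ) / (y : ℂ) ^ (3 + 2 * l)) := by
    rw [Finset.mul_sum]
    exact Finset.sum_congr rfl fun l _ => by ring
  rw [e2]
  field_simp
  ring

end NCQFT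


open NCQFT in
/-- The residue kernel inverts `f ↦ z²K̂(f/z)` on even Laurent polynomials:
for `f(z) = Σ_{k≤K} a_{2k}/z^{2k}` and
`(If)(z) = (1/ϱ₀)Σ_{k≤K} a_{2k} Σ_{j≤k} S_j(ϱ)/(j! z^{2k−2j+2})`, one has
`z²·K̂(y ↦ (If)(y)/y)(z) = f(z)` at every admissible `z`. -/
theorem stmt5 (a b s nbar : ℝ) (r : ℝ → ℝ)
    (ha : 0 < a) (hab : a < b)
    (hr : ContinuousOn r (Set.Icc a b)) (hrpos : ∀ y ∈ Set.Icc a b, 0 ≤ r y)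
    (hs : 0 < s) (hρ0 : moment a b s r 0 ≠ 0)
    (K : ℕ) (A : ℕ → ℝ) (z : ℂ) (hz : Admissible a b z) :
    z ^ 2 * Khat a b s nbar r
      (fun y => ((1 / (moment a b s r 0 : ℂ)) *
          ∑ k ∈ Finset.range (K + 1), (A k : ℂ) *
            ∑ j ∈ Finset.range (k + 1),
              (Sm (moment a b s r) j : ℂ) /
                (((j.factorial : ℕ) : ℂ) * y ^ (2 * k - 2 * j + 2))) / y) z
      = ∑ k ∈ Finset.range (K + 1), (A k : ℂ) / z ^ (2 * k) := by
  have hz0 := hz.1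
  set ρ := moment a b s r with hρ
  have hρc : (ρ 0 : ℂ) ≠ 0 := by exact_mod_cast hρ0
  have hfun : (fun y : ℂ => ((1 / (ρ 0 : ℂ)) *
          ∑ k ∈ Finset.range (K + 1), (A k : ℂ) *
            ∑ j ∈ Finset.range (k + 1),
              (Sm ρ j : ℂ) /
                (((j.factorial : ℕ) : ℂ) * y ^ (2 * k - 2 * j + 2))) / y)
      = fun y => ∑ k ∈ Finset.range (K + 1), ((1 / (ρ 0 : ℂ)) * (A k : ℂ)) *
          (fun k y => ∑ j ∈ Finset.range (k + 1), ((Sm ρ j : ℂ) / (j.factorial : ℂ)) *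
            (fun j y => 1 / y ^ (2 * (k - j) + 3)) j y) k y := by
    funext y
    simp only [Finset.mul_sum, Finset.sum_div]
    refine Finset.sum_congr rfl fun k _ => Finset.sum_congr rfl fun j _ => ?_
    rw [show 2 * k - 2 * j + 2 = 2 * (k - j) + 2 by omega, pow_succ y (2 * (k - j) + 2)]
    simp only [div_eq_mul_inv, mul_inv]
    ring
  have hc : ∀ k : ℕ, ∀ j ∈ Finset.range (k + 1), ContinuousOn
      (fun y : ℝ => (fun (j : ℕ) (y : ℂ) => 1 / y ^ (2 * (k - j) + 3)) j (y : ℂ)) (Set.Icc a b) :=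
    fun k j _ => cont_mono ha _
  rw [hfun, Khat_sum ha hab hr hz, Finset.mul_sum]
  · refine Finset.sum_congr rfl fun k _ => ?_
    rw [Khat_sum ha hab hr hz _ _ _ (hc k)]
    have h := Sm_conv ρ hρ0 (1 / z ^ 2) k
    have h2 : z ^ 2 * ∑ j ∈ Finset.range (k + 1), ((Sm ρ j : ℂ) / (j.factorial : ℂ)) *
        Khat a b s nbar r ((fun (j : ℕ) (y : ℂ) => 1 / y ^ (2 * (k - j) + 3)) j) z
        = (ρ 0 : ℂ) * (1 / z ^ 2) ^ k := by
      rw [← h, Finset.mul_sum]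
      refine Finset.sum_congr rfl fun j _ => ?_
      rw [← Khat_mono (nbar := nbar) ha hab hr hz (k - j)]
      ring
    rw [mul_left_comm, h2, div_pow, one_pow, ← pow_mul]
    field_simp
  · intro k _
    exact continuousOn_finsetSum _ fun j hj => continuousOn_const.mul (hc k j hj)
end
end
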